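/- arXiv:2409.00261 — 13 statements merged into one kernel-verified Lean document; each statement's English description precedes it below -/
import Mathlib

section
/- The partial sums satisfy the four-term recursion (a_m/α_{m+1})·q_{m+1}(x;t) + ((t·α_{m+1}(b_m − x) − a_m·α_m)/(α_m·α_{m+1}))·q_m(x;t) + t·((t·c_m·α_m − α_{m−1}(b_m − x))/(α_{m−1}·α_m))·q_{m−1}(x;t) − (t²·c_m/α_{m−1})·q_{m−2}(x;t) = 0 for all m ≥ 1, with initial values q_{−2}(x;t) = q_{−1}(x;t) = 0 and q_0(x;t) = 1. -/
open Polynomial Finset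

/-- the partial sums `q_m(x;t) = Σ_{n=0}^m t^n α_n p_n(x)` (with the
convention `q_m = 0` for `m < 0`) satisfy the four-term recursion
`(a_m/α_{m+1})·q_{m+1} + ((t·α_{m+1}(b_m−x) − a_m·α_m)/(α_m·α_{m+1}))·q_m
 + t·((t·c_m·α_m − α_{m−1}(b_m−x))/(α_{m−1}·α_m))·q_{m−1} − (t²·c_m/α_{m−1})·q_{m−2} = 0`
for all `m ≥ 1`, with initial values `q_{−2} = q_{−1} = 0`, `q_0 = 1`. -/
theorem four_term_recursion_partial_sums
    (a b c : ℕ → ℝ) (ha : ∀ n, a n ≠ 0)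
    (p : ℕ → Polynomial ℝ)
    (hp0 : p 0 = 1)
    (hrec0 : Polynomial.X * p 0 = Polynomial.C (a 0) * p 1 + Polynomial.C (b 0) * p 0)
    (hrec : ∀ n : ℕ, Polynomial.X * p (n + 1) =
      Polynomial.C (a (n + 1)) * p (n + 2) + Polynomial.C (b (n + 1)) * p (n + 1)
        + Polynomial.C (c (n + 1)) * p n)
    (α : ℕ → ℝ) (hα0 : α 0 = 1) (hα : ∀ n, α n ≠ 0)
    (x t : ℝ)
    (q : ℤ → ℝ)
    (hqneg : ∀ m : ℤ, m < 0 → q m = 0)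
    (hq : ∀ m : ℤ, 0 ≤ m →
      q m = ∑ n ∈ Finset.range (m.toNat + 1), t ^ n * α n * (p n).eval x) :
    q 0 = 1 ∧ q (-1) = 0 ∧ q (-2) = 0 ∧
    ∀ m : ℤ, 1 ≤ m →
      a m.toNat / α (m.toNat + 1) * q (m + 1)
        + (t * α (m.toNat + 1) * (b m.toNat - x) - a m.toNat * α m.toNat)
            / (α m.toNat * α (m.toNat + 1)) * q m
        + t * ((t * c m.toNat * α m.toNat - α (m.toNat - 1) * (b m.toNat - x))
            / (α (m.toNat - 1) * α m.toNat)) * q (m - 1)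
        - t ^ 2 * c m.toNat / α (m.toNat - 1) * q (m - 2) = 0 := by
  refine ⟨by rw [hq 0 le_rfl]; simp [hp0, hα0], hqneg _ (by norm_num), hqneg _ (by norm_num), ?_⟩
  have step : ∀ k : ℕ, q (k : ℤ) = q ((k : ℤ) - 1) + t ^ k * α k * (p k).eval x := by
    intro k
    cases k with
    | zero =>
      rw [hq _ (by simp), hqneg _ (by simp)]
      simp
    | succ n =>
      have e : ((n + 1 : ℕ) : ℤ) - 1 = (n : ℤ) := by push_cast; ring
      rw [e, hq _ (by positivity), hq (n : ℤ) (by positivity), Int.toNat_natCast,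
        Int.toNat_natCast, Finset.sum_range_succ]
  intro m hm
  obtain ⟨k, rfl⟩ : ∃ k : ℕ, m = ((k + 1 : ℕ) : ℤ) := ⟨m.toNat - 1, by omega⟩
  have h2 := step (k + 2)
  have h1 := step (k + 1)
  have h0 := step k
  have e2 : ((k + 2 : ℕ) : ℤ) - 1 = ((k + 1 : ℕ) : ℤ) := by push_cast; ring
  have e1 : ((k + 1 : ℕ) : ℤ) - 1 = (k : ℤ) := by push_cast; ring
  have e0 : ((k + 1 : ℕ) : ℤ) - 2 = (k : ℤ) - 1 := by push_cast; ring
  have e3 : ((k + 1 : ℕ) : ℤ) + 1 = ((k + 2 : ℕ) : ℤ) := by push_cast; ring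
  have hr := congrArg (Polynomial.eval x) (hrec k)
  simp only [eval_mul, eval_add, eval_X, eval_C] at hr
  rw [e2] at h2
  rw [e1] at h1
  rw [e3, e1, e0, Int.toNat_natCast, Nat.add_sub_cancel, h2, h1, h0]
  have A0 := hα k
  have A1 := hα (k + 1)
  have A2 : α (k + 1 + 1) ≠ 0 := hα (k + 2)
  rw [show k + 2 = k + 1 + 1 from rfl] at *
  generalize q ((k : ℤ) - 1) = Q
  field_simp
  linear_combination (-(t ^ (k + 2) * α k * α (k + 1) * α (k + 1 + 1))) * hr
end

section
/- For every N ∈ ℕ, every t ∈ ℝ and every x ∈ ℝ, one has q_{N+1}(x;t) = (−1)^{N+1} · (∏_{k=0}^{N} α_{k+1}/a_k) · det(L_N(t) − x·t·M_N). -/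
open Polynomial Finset Matrix

/-- The matrix `L_N(t)` from the paper: four nontrivial diagonals. -/
noncomputable def Lmat (a b c α : ℕ → ℝ) (N : ℕ) (t : ℝ) :
    Matrix (Fin (N + 1)) (Fin (N + 1)) ℝ :=
  Matrix.of fun i j =>
    if (j : ℕ) = (i : ℕ) + 1 then a (i : ℕ) / α ((i : ℕ) + 1)
    else if (j : ℕ) = (i : ℕ) then
      (t * α ((i : ℕ) + 1) * b (i : ℕ) - a (i : ℕ) * α (i : ℕ))
        / (α (i : ℕ) * α ((i : ℕ) + 1))
    else if (i : ℕ) = (j : ℕ) + 1 then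
      t * ((t * c (i : ℕ) * α (i : ℕ) - α (j : ℕ) * b (i : ℕ)) / (α (j : ℕ) * α (i : ℕ)))
    else if (i : ℕ) = (j : ℕ) + 2 then - (t ^ 2 * c (i : ℕ) / α ((j : ℕ) + 1))
    else 0

/-- The lower bidiagonal matrix `M_N` from the paper. -/
noncomputable def Mmat (α : ℕ → ℝ) (N : ℕ) :
    Matrix (Fin (N + 1)) (Fin (N + 1)) ℝ :=
  Matrix.of fun i j =>
    if (j : ℕ) = (i : ℕ) then 1 / α (i : ℕ)
    else if (i : ℕ) = (j : ℕ) + 1 then - (1 / α (i : ℕ))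
    else 0

/-- Entries of the matrix with natural-number indices. -/
noncomputable def entF (a b c α : ℕ → ℝ) (t x : ℝ) (i j : ℕ) : ℝ :=
    (if j = i + 1 then a i / α (i + 1)
    else if j = i then
      (t * α (i + 1) * b i - a i * α i) / (α i * α (i + 1))
    else if i = j + 1 then
      t * ((t * c i * α i - α j * b i) / (α j * α i))
    else if i = j + 2 then - (t ^ 2 * c i / α (j + 1))
    else 0) - (x * t) * (if j = i then 1 / α i
    else if i = j + 1 then - (1 / α i)
    else 0)

lemma entF_super (a b c α : ℕ → ℝ) (t x : ℝ) (i : ℕ) :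
    entF a b c α t x i (i + 1) = a i / α (i + 1) := by
  unfold entF
  rw [if_pos rfl, if_neg (by omega), if_neg (by omega)]
  simp

lemma entF_sum (a b c α P : ℕ → ℝ) (t x : ℝ) (hα : ∀ n, α n ≠ 0)
    (h0 : x * P 0 = a 0 * P 1 + b 0 * P 0)
    (h : ∀ n, x * P (n + 1) = a (n + 1) * P (n + 2) + b (n + 1) * P (n + 1) + c (n + 1) * P n)
    (m : ℕ) :
    ∑ j ∈ Finset.range (m + 2), entF a b c α t x m j *
      (∑ n ∈ Finset.range (j + 1), t ^ n * α n * P n) = 0 := by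
  set Q : ℕ → ℝ := fun j => ∑ n ∈ Finset.range (j + 1), t ^ n * α n * P n with hQ
  have hQs : ∀ j, Q (j + 1) = Q j + t ^ (j + 1) * α (j + 1) * P (j + 1) := fun j => by
    simp only [hQ]; rw [Finset.sum_range_succ _ (j + 1)]
  have hQ0 : Q 0 = α 0 * P 0 := by simp [hQ]
  change ∑ j ∈ Finset.range (m + 2), entF a b c α t x m j * Q j = 0
  rcases m with _ | _ | k
  · have e0 := hα 0
    have e1 := hα 1
    simp only [Finset.sum_range_succ, Finset.sum_range_zero, hQs, hQ0, entF]
    simp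
    field_simp
    linear_combination (-t * α 1) * h0
  · have e0 := hα 0
    have e1 := hα 1
    have e2 := hα 2
    have h1 := h 0
    simp only [zero_add] at h1
    simp only [Finset.sum_range_succ, Finset.sum_range_zero, hQs, hQ0, entF]
    simp
    field_simp
    linear_combination (-t ^ 2 * α 1 * α 2) * h1
  · have e0 := hα k
    have e1 := hα (k + 1)
    have e2 := hα (k + 2)
    have e3 := hα (k + 3)
    have h1 := h (k + 1)
    rw [Finset.sum_range_succ, Finset.sum_range_succ, Finset.sum_range_succ,
      Finset.sum_range_succ, Finset.sum_eq_zero]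
    · have A0 : entF a b c α t x (k + 2) k = - (t ^ 2 * c (k + 2) / α (k + 1)) := by
        simp [entF]
        intro hh
        omega
      have A1 : entF a b c α t x (k + 2) (k + 1) =
          t * ((t * c (k + 2) * α (k + 2) - α (k + 1) * b (k + 2)) / (α (k + 1) * α (k + 2)))
           + x * t * (1 / α (k + 2)) := by
        simp [entF]
      have A2 : entF a b c α t x (k + 2) (k + 2) =
          (t * α (k + 3) * b (k + 2) - a (k + 2) * α (k + 2)) / (α (k + 2) * α (k + 3))
           - x * t * (1 / α (k + 2)) := by
        simp [entF]
      have A3 : entF a b c α t x (k + 2) (k + 3) = a (k + 2) / α (k + 3) := by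
        simp [entF]
      have B1 := hQs k
      have B2 := hQs (k + 1)
      have B3 := hQs (k + 2)
      simp only [add_assoc, Nat.reduceAdd] at *
      rw [A0, A1, A2, A3, B3, B2, B1]
      field_simp
      linear_combination (-t ^ (k + 3) * α (k + 1) * α (k + 2) * α (k + 3)) * h1
    · intro j hj
      have := Finset.mem_range.1 hj
      unfold entF
      rw [if_neg (by omega), if_neg (by omega), if_neg (by omega), if_neg (by omega),
        if_neg (by omega), if_neg (by omega)]
      simp

/-- `q_{N+1}(x;t) = (−1)^{N+1} · (∏_{k=0}^{N} α_{k+1}/a_k) · det(L_N(t) − x·t·M_N)`. -/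
theorem partial_sum_as_det
    (a b c : ℕ → ℝ) (ha : ∀ n, a n ≠ 0)
    (p : ℕ → Polynomial ℝ)
    (hp0 : p 0 = 1)
    (hrec0 : Polynomial.X * p 0 = Polynomial.C (a 0) * p 1 + Polynomial.C (b 0) * p 0)
    (hrec : ∀ n : ℕ, Polynomial.X * p (n + 1) =
      Polynomial.C (a (n + 1)) * p (n + 2) + Polynomial.C (b (n + 1)) * p (n + 1)
        + Polynomial.C (c (n + 1)) * p n)
    (α : ℕ → ℝ) (hα0 : α 0 = 1) (hα : ∀ n, α n ≠ 0)
    (N : ℕ) (t x : ℝ) :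
    (∑ n ∈ Finset.range (N + 2), t ^ n * α n * (p n).eval x) =
      (-1 : ℝ) ^ (N + 1) * (∏ k ∈ Finset.range (N + 1), α (k + 1) / a k) *
        (Lmat a b c α N t - (x * t) • Mmat α N).det := by
  classical
  set A := Lmat a b c α N t - (x * t) • Mmat α N with hA
  have hAe : ∀ i j, A i j = entF a b c α t x i j := fun i j => by
    simp [hA, Lmat, Mmat, entF]
  set P : ℕ → ℝ := fun n => (p n).eval x with hP
  have h0 : x * P 0 = a 0 * P 1 + b 0 * P 0 := by
    simpa using congrArg (Polynomial.eval x) hrec0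
  have h : ∀ n, x * P (n + 1) =
      a (n + 1) * P (n + 2) + b (n + 1) * P (n + 1) + c (n + 1) * P n := fun n => by
    simpa using congrArg (Polynomial.eval x) (hrec n)
  have key := entF_sum a b c α P t x hα h0 h
  set Q : ℕ → ℝ := fun j => ∑ n ∈ Finset.range (j + 1), t ^ n * α n * P n with hQ
  have hQ0 : Q 0 = 1 := by simp [hQ, hP, hα0, hp0]
  change Q (N + 1) = _
  have hAq : A *ᵥ (fun j : Fin (N + 1) => Q j) =
      Pi.single (Fin.last N) (-(a N / α (N + 1)) * Q (N + 1)) := by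
    funext i
    have e : (A *ᵥ (fun j : Fin (N + 1) => Q j)) i =
        ∑ j ∈ Finset.range (N + 1), entF a b c α t x i j * Q j := by
      rw [← Fin.sum_univ_eq_sum_range (fun j => entF a b c α t x i j * Q j)]
      simp [Matrix.mulVec, dotProduct, hAe]
    rw [e]
    have hk : ∑ j ∈ Finset.range ((i : ℕ) + 2), entF a b c α t x i j * Q j = 0 := key i
    rcases Fin.eq_castSucc_or_eq_last i with ⟨i, rfl⟩ | rfl
    · rw [Pi.single_eq_of_ne (Fin.castSucc_lt_last i).ne, ← hk]
      symm
      apply Finset.sum_subset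
      · intro j
        have := i.2
        simp only [Finset.mem_range, Fin.val_castSucc]
        omega
      · intro j _ hj
        simp only [Finset.mem_range, Fin.val_castSucc] at hj ⊢
        unfold entF
        rw [if_neg (by omega), if_neg (by omega), if_neg (by omega), if_neg (by omega),
          if_neg (by omega), if_neg (by omega)]
        simp
    · rw [Finset.sum_range_succ] at hk
      simp only [Fin.val_last] at hk ⊢
      have : entF a b c α t x N (N + 1) = a N / α (N + 1) := entF_super ..
      rw [this] at hk
      simp only [Pi.single_eq_same]
      linarith
  have hdet : A.adjugate 0 (Fin.last N) * (-(a N / α (N + 1)) * Q (N + 1)) = A.det := by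
    have := congrArg (fun v => (A.adjugate *ᵥ v) 0) hAq
    simp only [Matrix.mulVec_mulVec, Matrix.adjugate_mul, Matrix.smul_mulVec,
      Matrix.one_mulVec, Matrix.mulVec_single] at this
    simp [hQ0] at this
    rw [this]; ring
  have hadj : A.adjugate 0 (Fin.last N) =
      (-1) ^ N * ∏ k ∈ Finset.range N, a k / α (k + 1) := by
    rw [Matrix.adjugate_fin_succ_eq_det_submatrix, Matrix.det_of_isLowerTriangular]
    · rw [← Fin.prod_univ_eq_prod_range (fun k => a k / α (k + 1))]
      simp [hAe, entF_super]
    · intro i j hij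
      have hij : (i : ℕ) < j := hij
      simp only [Matrix.submatrix_apply, hAe, Fin.succAbove_last, Fin.succAbove_zero,
        Fin.val_castSucc, Fin.val_succ]
      unfold entF
      rw [if_neg (by omega), if_neg (by omega), if_neg (by omega), if_neg (by omega),
        if_neg (by omega), if_neg (by omega)]
      simp
  rw [← hdet, hadj, Finset.prod_range_succ]
  have hpp : (∏ k ∈ Finset.range N, α (k + 1) / a k) *
      (∏ k ∈ Finset.range N, a k / α (k + 1)) = 1 := by
    rw [← Finset.prod_mul_distrib]
    apply Finset.prod_eq_one
    intro k _
    have := ha k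
    have := hα (k + 1)
    field_simp
  have hN : α (N + 1) / a N * (a N / α (N + 1)) = 1 := by
    have := ha N
    have := hα (N + 1)
    field_simp
  have hs : (-1 : ℝ) ^ N * (-1) ^ N = 1 := by
    rw [← mul_pow]; simp
  generalize (∏ k ∈ Finset.range N, α (k + 1) / a k) = X1 at *
  generalize (∏ k ∈ Finset.range N, a k / α (k + 1)) = X2 at *
  generalize α (N + 1) / a N = X3 at *
  generalize a N / α (N + 1) = X4 at *
  rw [pow_succ]
  generalize (-1 : ℝ) ^ N = s at *
  calc Q (N + 1) = (s * s) * (X1 * X2) * (X3 * X4) * Q (N + 1) := by rw [hs, hpp, hN]; ring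
    _ = _ := by ring
end

section
/- For every N ∈ ℕ, every t ≠ 0 and every x ∈ ℝ, the kernel of the matrix L_N(t) − x·t·M_N (equivalently, the eigenspace of P_N(t) = t^{−1}·L_N(t)·M_N^{−1} for the eigenvalue x) has dimension at most 1; i.e. the geometric multiplicity of any eigenvalue of P_N(t) is 1. -/
open Polynomial Finset Matrix

/-- for `t ≠ 0` and any `x ∈ ℝ`, the kernel of `L_N(t) − x·t·M_N`
(the eigenspace of `P_N(t) = t⁻¹·L_N(t)·M_N⁻¹` for the eigenvalue `x`) has dimension
at most `1`: the geometric multiplicity of any eigenvalue of `P_N(t)` is `1`. -/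
theorem geometric_multiplicity_one
    (a b c : ℕ → ℝ) (ha : ∀ n, a n ≠ 0)
    (α : ℕ → ℝ) (hα0 : α 0 = 1) (hα : ∀ n, α n ≠ 0)
    (N : ℕ) (t : ℝ) (ht : t ≠ 0) (x : ℝ) :
    Module.finrank ℝ
      (LinearMap.ker (Matrix.toLin' (Lmat a b c α N t - (x * t) • Mmat α N))) ≤ 1 := by
  set A := Lmat a b c α N t - (x * t) • Mmat α N with hA
  have hsup : ∀ i j : Fin (N + 1), (j : ℕ) = (i : ℕ) + 1 → A i j ≠ 0 := by
    intro i j h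
    have h1 : ¬ ((i : ℕ) + 1 = (i : ℕ)) := by omega
    have h2 : ¬ ((i : ℕ) = (i : ℕ) + 1 + 1) := by omega
    simp [hA, Lmat, Mmat, h, ha, hα, h2]
  have hzero : ∀ i j : Fin (N + 1), (i : ℕ) + 1 < (j : ℕ) → A i j = 0 := by
    intro i j h
    have h1 : ¬ ((j : ℕ) = (i : ℕ) + 1) := by omega
    have h2 : ¬ ((j : ℕ) = (i : ℕ)) := by omega
    have h3 : ¬ ((i : ℕ) = (j : ℕ) + 1) := by omega
    have h4 : ¬ ((i : ℕ) = (j : ℕ) + 2) := by omega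
    simp [hA, Lmat, Mmat, h1, h2, h3, h4]
  have key : ∀ v : Fin (N + 1) → ℝ, A *ᵥ v = 0 → v 0 = 0 → v = 0 := by
    intro v hv h0
    have main : ∀ n : ℕ, ∀ h : n < N + 1, v ⟨n, h⟩ = 0 := by
      intro n
      induction n using Nat.strong_induction_on with
      | _ n ih =>
        intro h
        rcases n with _ | m
        · exact h0
        · have hm : m < N + 1 := by omega
          have e := congrFun hv ⟨m, hm⟩
          rw [Matrix.mulVec, dotProduct, Finset.sum_eq_single ⟨m + 1, h⟩] at e
          · exact (mul_eq_zero.mp e).resolve_left (hsup _ _ rfl)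
          · intro j _ hj
            by_cases hlt : (j : ℕ) < m + 1
            · have := ih j hlt j.2
              rw [show v j = 0 from this, mul_zero]
            · have hne : (j : ℕ) ≠ m + 1 := fun q => hj (Fin.ext q)
              rw [hzero _ _ (show m + 1 < (j : ℕ) by omega), zero_mul]
          · intro q
            exact absurd (Finset.mem_univ _) q
    funext i
    exact main i i.2
  let f : LinearMap.ker (Matrix.toLin' A) →ₗ[ℝ] ℝ :=
    (LinearMap.proj (0 : Fin (N + 1))).comp (LinearMap.ker (Matrix.toLin' A)).subtype
  have hf : Function.Injective f := by
    rw [injective_iff_map_eq_zero]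
    rintro ⟨v, hv⟩ h
    have hv' : A *ᵥ v = 0 := by simpa using hv
    exact Subtype.ext (key v hv' h)
  have := LinearMap.finrank_le_finrank_of_injective hf
  simpa using this
end

section
/- Let t_0 ≠ 0 and suppose the polynomial x ↦ q_{N+1}(x;t_0) has a zero at x_0 ∈ ℝ of multiplicity at least 2 (i.e. (x − x_0)² divides q_{N+1}(x;t_0)). Then the matrix P_N(t_0) has a higher-order Jordan block at the eigenvalue x_0: there exists a vector w ∈ ℝ^{N+1} with (P_N(t_0) − x_0·I)·w ≠ 0 and (P_N(t_0) − x_0·I)²·w = 0. -/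
open Polynomial Finset Matrix

lemma aux_M_mulVec (α : ℕ → ℝ) (hα : ∀ n, α n ≠ 0) (N : ℕ) (t : ℝ) (s : ℕ → ℝ) :
    Mmat α N *ᵥ (fun m : Fin (N + 1) => ∑ n ∈ Finset.range (m + 1), t ^ n * α n * s n)
      = fun m : Fin (N + 1) => t ^ (m : ℕ) * s m := by
  set Q : ℕ → ℝ := fun m => ∑ n ∈ Finset.range (m + 1), t ^ n * α n * s n with hQ
  have hQs : ∀ m, Q (m + 1) = Q m + t ^ (m + 1) * α (m + 1) * s (m + 1) := fun m => by
    simp only [hQ]; rw [Finset.sum_range_succ]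
  have hQ0 : Q 0 = α 0 * s 0 := by simp [hQ]
  ext ⟨i, hi⟩
  simp only [Mmat, Matrix.mulVec, dotProduct, Matrix.of_apply]
  rw [Fin.sum_univ_eq_sum_range (fun j => (if j = i then 1 / α i
    else if i = j + 1 then - (1 / α i) else 0) * Q j) (N + 1)]
  rcases i with _ | i
  · have : ∀ j, (if j = 0 then 1 / α 0
        else if 0 = j + 1 then - (1 / α 0) else 0) * Q j
        = if j = 0 then 1 / α 0 * Q 0 else 0 := by
      intro j
      split_ifs <;> first | omega | contradiction | (exfalso; omega) | (subst_vars; ring1)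
    simp only [this, Finset.sum_ite_eq', Finset.mem_range, hi, if_true, hQ0]
    have := hα 0
    field_simp
  · have : ∀ j, (if j = i + 1 then 1 / α (i + 1)
        else if i + 1 = j + 1 then - (1 / α (i + 1)) else 0) * Q j
        = (if j = i + 1 then 1 / α (i + 1) * Q (i + 1) else 0)
          + (if j = i then - (1 / α (i + 1)) * Q i else 0) := by
      intro j
      split_ifs <;> first | omega | contradiction | (exfalso; omega) | (subst_vars; ring1)
    simp only [this, Finset.sum_add_distrib, Finset.sum_ite_eq', Finset.mem_range, hi,
      show i < N + 1 by omega, if_true, hQs]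
    have := hα (i + 1)
    field_simp
    ring

lemma aux_L_mulVec (a b c α : ℕ → ℝ) (hα : ∀ n, α n ≠ 0) (N : ℕ) (t : ℝ) (s y : ℕ → ℝ)
    (hy0 : y 0 = a 0 * s 1 + b 0 * s 0)
    (hy : ∀ n, y (n + 1) = a (n + 1) * s (n + 2) + b (n + 1) * s (n + 1) + c (n + 1) * s n)
    (hN : ∑ n ∈ Finset.range (N + 2), t ^ n * α n * s n = 0) :
    Lmat a b c α N t *ᵥ
        (fun m : Fin (N + 1) => ∑ n ∈ Finset.range (m + 1), t ^ n * α n * s n)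
      = fun m : Fin (N + 1) => t * (t ^ (m : ℕ) * y m) := by
  set Q : ℕ → ℝ := fun m => ∑ n ∈ Finset.range (m + 1), t ^ n * α n * s n with hQ
  have hQs : ∀ m, Q (m + 1) = Q m + t ^ (m + 1) * α (m + 1) * s (m + 1) := fun m => by
    simp only [hQ]; rw [Finset.sum_range_succ]
  have hQ0 : Q 0 = α 0 * s 0 := by simp [hQ]
  have hQN : Q (N + 1) = 0 := hN
  change Lmat a b c α N t *ᵥ (fun m : Fin (N + 1) => Q m) = _
  clear_value Q
  ext ⟨i, hi⟩
  simp only [Lmat, Matrix.mulVec, dotProduct, Matrix.of_apply]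
  rw [Fin.sum_univ_eq_sum_range (fun j => (if j = i + 1 then a i / α (i + 1)
    else if j = i then (t * α (i + 1) * b i - a i * α i) / (α i * α (i + 1))
    else if i = j + 1 then t * ((t * c i * α i - α j * b i) / (α j * α i))
    else if i = j + 2 then - (t ^ 2 * c i / α (j + 1)) else 0) * Q j) (N + 1)]
  -- extend the sum by the vanishing term
  rw [← add_zero (∑ j ∈ Finset.range (N + 1), _)]
  have hext : ∀ F : ℕ → ℝ, ∑ j ∈ Finset.range (N + 1), F j * Q j + 0
      = ∑ j ∈ Finset.range (N + 2), F j * Q j := fun F => by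
    rw [Finset.sum_range_succ _ (N + 1), hQN, mul_zero]
  rw [hext]
  have h1 : i + 1 < N + 2 := by omega
  have h2 : i < N + 2 := by omega
  rcases i with _ | _ | i
  · have : ∀ j, (if j = 0 + 1 then a 0 / α (0 + 1)
        else if j = 0 then (t * α (0 + 1) * b 0 - a 0 * α 0) / (α 0 * α (0 + 1))
        else if 0 = j + 1 then t * ((t * c 0 * α 0 - α j * b 0) / (α j * α 0))
        else if 0 = j + 2 then - (t ^ 2 * c 0 / α (j + 1)) else 0) * Q j
        = (if j = 0 + 1 then a 0 / α (0 + 1) * Q (0 + 1) else 0)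
          + (if j = 0 then (t * α (0 + 1) * b 0 - a 0 * α 0) / (α 0 * α (0 + 1)) * Q 0
              else 0) := by
      intro j
      split_ifs <;> first | omega | contradiction | (exfalso; omega) | (subst_vars; ring1)
    simp only [this, Finset.sum_add_distrib, Finset.sum_ite_eq', Finset.mem_range, h1, h2,
      if_true, hQs, hQ0, hy0]
    have := hα 0
    have := hα (0 + 1)
    field_simp
    simp
    try ring
  · have : ∀ j, (if j = 0 + 1 + 1 then a (0 + 1) / α (0 + 1 + 1)
        else if j = 0 + 1 then (t * α (0 + 1 + 1) * b (0 + 1) - a (0 + 1) * α (0 + 1))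
          / (α (0 + 1) * α (0 + 1 + 1))
        else if 0 + 1 = j + 1 then
          t * ((t * c (0 + 1) * α (0 + 1) - α j * b (0 + 1)) / (α j * α (0 + 1)))
        else if 0 + 1 = j + 2 then - (t ^ 2 * c (0 + 1) / α (j + 1)) else 0) * Q j
        = (if j = 0 + 1 + 1 then a (0 + 1) / α (0 + 1 + 1) * Q (0 + 1 + 1) else 0)
          + (if j = 0 + 1 then (t * α (0 + 1 + 1) * b (0 + 1) - a (0 + 1) * α (0 + 1))
          / (α (0 + 1) * α (0 + 1 + 1)) * Q (0 + 1) else 0)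
          + (if j = 0 then t * ((t * c (0 + 1) * α (0 + 1) - α 0 * b (0 + 1))
              / (α 0 * α (0 + 1))) * Q 0 else 0) := by
      intro j
      split_ifs <;> first | omega | contradiction | (exfalso; omega) | (subst_vars; ring1)
    simp only [this, Finset.sum_add_distrib, Finset.sum_ite_eq', Finset.mem_range, h1, h2,
      show 0 < N + 2 by omega, if_true, hQs, hQ0, hy]
    have := hα 0
    have := hα (0 + 1)
    have := hα (0 + 1 + 1)
    field_simp
    simp
    try ring
  · have : ∀ j, (if j = i + 1 + 1 + 1 then a (i + 1 + 1) / α (i + 1 + 1 + 1)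
        else if j = i + 1 + 1 then
          (t * α (i + 1 + 1 + 1) * b (i + 1 + 1) - a (i + 1 + 1) * α (i + 1 + 1))
          / (α (i + 1 + 1) * α (i + 1 + 1 + 1))
        else if i + 1 + 1 = j + 1 then
          t * ((t * c (i + 1 + 1) * α (i + 1 + 1) - α j * b (i + 1 + 1))
            / (α j * α (i + 1 + 1)))
        else if i + 1 + 1 = j + 2 then - (t ^ 2 * c (i + 1 + 1) / α (j + 1)) else 0) * Q j
        = (if j = i + 1 + 1 + 1 then a (i + 1 + 1) / α (i + 1 + 1 + 1) * Q (i + 1 + 1 + 1)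
            else 0)
          + (if j = i + 1 + 1 then
          (t * α (i + 1 + 1 + 1) * b (i + 1 + 1) - a (i + 1 + 1) * α (i + 1 + 1))
          / (α (i + 1 + 1) * α (i + 1 + 1 + 1)) * Q (i + 1 + 1) else 0)
          + (if j = i + 1 then t * ((t * c (i + 1 + 1) * α (i + 1 + 1)
              - α (i + 1) * b (i + 1 + 1)) / (α (i + 1) * α (i + 1 + 1))) * Q (i + 1) else 0)
          + (if j = i then - (t ^ 2 * c (i + 1 + 1) / α (i + 1)) * Q i else 0) := by
      intro j
      split_ifs <;> first
        | omega
        | contradiction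
        | (exfalso; omega) | (subst_vars; ring1)
        | (obtain rfl : j = i + 1 := by omega
           ring1)
        | (obtain rfl : j = i := by omega
           ring1)
    simp only [this, Finset.sum_add_distrib, Finset.sum_ite_eq', Finset.mem_range, h1, h2,
      show i < N + 2 by omega, show i + 1 < N + 2 by omega, if_true, hQs, hy]
    have := hα (i + 1)
    have := hα (i + 1 + 1)
    have := hα (i + 1 + 1 + 1)
    field_simp
    ring

lemma aux_M_det (α : ℕ → ℝ) (hα : ∀ n, α n ≠ 0) (N : ℕ) : IsUnit (Mmat α N).det := by
  rw [Matrix.det_of_lowerTriangular]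
  · rw [isUnit_iff_ne_zero, Finset.prod_ne_zero_iff]
    intro i _
    simp [Mmat, hα]
  · intro i j hij
    have hij' : (i : ℕ) < j := by simpa using hij
    simp only [Mmat, Matrix.of_apply]
    rw [if_neg (by omega), if_neg (by omega)]

lemma aux_P_mulVec (a b c α : ℕ → ℝ) (hα : ∀ n, α n ≠ 0) (N : ℕ) (t : ℝ) (ht : t ≠ 0)
    (s y : ℕ → ℝ)
    (hy0 : y 0 = a 0 * s 1 + b 0 * s 0)
    (hy : ∀ n, y (n + 1) = a (n + 1) * s (n + 2) + b (n + 1) * s (n + 1) + c (n + 1) * s n)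
    (hN : ∑ n ∈ Finset.range (N + 2), t ^ n * α n * s n = 0) :
    (t⁻¹ • (Lmat a b c α N t * (Mmat α N)⁻¹)) *ᵥ (fun m : Fin (N + 1) => t ^ (m : ℕ) * s m)
      = fun m : Fin (N + 1) => t ^ (m : ℕ) * y m := by
  rw [← aux_M_mulVec α hα N t s, Matrix.smul_mulVec, Matrix.mulVec_mulVec, Matrix.mul_assoc,
    Matrix.nonsing_inv_mul _ (aux_M_det α hα N), Matrix.mul_one,
    aux_L_mulVec a b c α hα N t s y hy0 hy hN]
  ext m
  simp [ht]

/-- if the polynomial `x ↦ q_{N+1}(x;t₀)` has a zero of multiplicity at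
least `2` at `x₀ ∈ ℝ`, then `P_N(t₀) = t₀⁻¹·L_N(t₀)·M_N⁻¹` has a higher-order Jordan
block at the eigenvalue `x₀`: there is `w` with `(P_N(t₀) − x₀)w ≠ 0` and
`(P_N(t₀) − x₀)²w = 0`. -/
theorem double_zero_gives_jordan_block
    (a b c : ℕ → ℝ) (ha : ∀ n, a n ≠ 0)
    (p : ℕ → Polynomial ℝ)
    (hp0 : p 0 = 1)
    (hrec0 : Polynomial.X * p 0 = Polynomial.C (a 0) * p 1 + Polynomial.C (b 0) * p 0)
    (hrec : ∀ n : ℕ, Polynomial.X * p (n + 1) =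
      Polynomial.C (a (n + 1)) * p (n + 2) + Polynomial.C (b (n + 1)) * p (n + 1)
        + Polynomial.C (c (n + 1)) * p n)
    (α : ℕ → ℝ) (hα0 : α 0 = 1) (hα : ∀ n, α n ≠ 0)
    (N : ℕ) (t₀ : ℝ) (ht₀ : t₀ ≠ 0) (x₀ : ℝ)
    (hdouble : (Polynomial.X - Polynomial.C x₀) ^ 2 ∣
      ∑ n ∈ Finset.range (N + 2), Polynomial.C (t₀ ^ n * α n) * p n) :
    ∃ w : Fin (N + 1) → ℝ,
      (t₀⁻¹ • (Lmat a b c α N t₀ * (Mmat α N)⁻¹) - x₀ • 1) *ᵥ w ≠ 0 ∧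
      (t₀⁻¹ • (Lmat a b c α N t₀ * (Mmat α N)⁻¹) - x₀ • 1) *ᵥ
        ((t₀⁻¹ • (Lmat a b c α N t₀ * (Mmat α N)⁻¹) - x₀ • 1) *ᵥ w) = 0 := by
  obtain ⟨r, hr⟩ := hdouble
  have hN0 : ∑ n ∈ Finset.range (N + 2), t₀ ^ n * α n * (p n).eval x₀ = 0 := by
    have := congrArg (Polynomial.eval x₀) hr
    rw [Polynomial.eval_finsetSum] at this
    simpa only [eval_mul, eval_C, eval_pow, eval_sub, eval_X, sub_self, ne_eq,
      OfNat.ofNat_ne_zero, not_false_eq_true, zero_pow, zero_mul] using this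
  have hN1 : ∑ n ∈ Finset.range (N + 2), t₀ ^ n * α n * (derivative (p n)).eval x₀ = 0 := by
    have := congrArg (fun q => Polynomial.eval x₀ (derivative q)) hr
    simp only [derivative_sum, Polynomial.eval_finsetSum, derivative_C_mul] at this
    simp only [eval_mul, eval_C] at this
    rw [this]
    simp [derivative_mul, derivative_pow]
  have h0 := aux_P_mulVec a b c α hα N t₀ ht₀ (fun n => (p n).eval x₀)
    (fun n => x₀ * (p n).eval x₀)
    (by simpa using congrArg (Polynomial.eval x₀) hrec0)
    (fun n => by simpa using congrArg (Polynomial.eval x₀) (hrec n)) hN0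
  have h1 := aux_P_mulVec a b c α hα N t₀ ht₀ (fun n => (derivative (p n)).eval x₀)
    (fun n => (p n).eval x₀ + x₀ * (derivative (p n)).eval x₀)
    (by
      have h := congrArg (fun q => Polynomial.eval x₀ (derivative q)) hrec0
      simpa [derivative_mul] using h)
    (fun n => by
      have h := congrArg (fun q => Polynomial.eval x₀ (derivative q)) (hrec n)
      simpa [derivative_mul] using h) hN1
  have hw : (t₀⁻¹ • (Lmat a b c α N t₀ * (Mmat α N)⁻¹) - x₀ • 1) *ᵥ
      (fun m : Fin (N + 1) => t₀ ^ (m : ℕ) * (derivative (p m)).eval x₀)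
      = fun m : Fin (N + 1) => t₀ ^ (m : ℕ) * (p m).eval x₀ := by
    rw [Matrix.sub_mulVec, h1, Matrix.smul_mulVec, Matrix.one_mulVec]
    ext m
    simp only [Pi.sub_apply, Pi.smul_apply, smul_eq_mul]
    ring
  refine ⟨fun m => t₀ ^ (m : ℕ) * (derivative (p m)).eval x₀, ?_, ?_⟩
  · rw [hw]
    intro h
    have := congrFun h 0
    simp [hp0] at this
  · rw [hw, Matrix.sub_mulVec, h0, Matrix.smul_mulVec, Matrix.one_mulVec]
    ext m
    simp only [Pi.sub_apply, Pi.smul_apply, smul_eq_mul, Pi.zero_apply]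
    ring
end

section
/- For every n ∈ ℕ, every N > n and every x ∈ ℝ, the polynomial p_n can be recovered from the determinant: p_n(x) = ((−1)^{N+1}/(α_n · n!)) · (∏_{k=0}^{N} α_{k+1}/a_k) · (d^n/dt^n)|_{t=0} det(L_N(t) − x·t·M_N), where t ↦ det(L_N(t) − x·t·M_N) is a polynomial in t. -/
open Polynomial Finset Matrix

noncomputable def Fent (a b c α : ℕ → ℝ) (x t : ℝ) (i j : ℕ) : ℝ :=
  (if j = i + 1 then a i / α (i + 1)
    else if j = i then (t * α (i + 1) * b i - a i * α i) / (α i * α (i + 1))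
    else if i = j + 1 then t * ((t * c i * α i - α j * b i) / (α j * α i))
    else if i = j + 2 then - (t ^ 2 * c i / α (j + 1))
    else 0) - (x * t) * (if j = i then 1 / α i else if i = j + 1 then - (1 / α i) else 0)

lemma Fent_zero (a b c α : ℕ → ℝ) (x t : ℝ) (i j : ℕ) (h : i + 1 < j) :
    Fent a b c α x t i j = 0 := by
  unfold Fent
  rw [if_neg (by omega), if_neg (by omega), if_neg (by omega), if_neg (by omega),
    if_neg (by omega), if_neg (by omega)]
  simp

lemma Fent_zero' (a b c α : ℕ → ℝ) (x t : ℝ) (i j : ℕ) (h : j + 2 < i) :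
    Fent a b c α x t i j = 0 := by
  unfold Fent
  rw [if_neg (by omega), if_neg (by omega), if_neg (by omega), if_neg (by omega),
    if_neg (by omega), if_neg (by omega)]
  simp

lemma Fent_sup (a b c α : ℕ → ℝ) (x t : ℝ) (i : ℕ) :
    Fent a b c α x t i (i + 1) = a i / α (i + 1) := by
  unfold Fent
  rw [if_pos rfl, if_neg (by omega), if_neg (by omega)]
  simp

lemma Fent_row (a b c α q : ℕ → ℝ) (x t : ℝ) (hα : ∀ n, α n ≠ 0)
    (hr0 : x * q 0 = a 0 * q 1 + b 0 * q 0)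
    (hr : ∀ n, x * q (n + 1) = a (n + 1) * q (n + 2) + b (n + 1) * q (n + 1) + c (n + 1) * q n)
    (i : ℕ) :
    ∑ j ∈ range (i + 2), Fent a b c α x t i j * (∑ k ∈ range (j + 1), α k * q k * t ^ k) = 0 := by
  rcases i with _ | _ | m
  · have h0 := hα 0
    have h1 := hα 1
    simp [Finset.sum_range_succ, Fent]
    field_simp
    linear_combination (-t * α 1) * hr0
  · have h0 := hα 0
    have h1 := hα 1
    have h2 := hα 2
    have e := hr 0
    simp [Finset.sum_range_succ, Fent]
    simp at e
    field_simp
    linear_combination (-t^2 * α 1 * α 2) * e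
  · have h0 := hα m
    have h1 := hα (m + 1)
    have h2 := hα (m + 2)
    have h3 := hα (m + 3)
    have e := hr (m + 1)
    rw [Finset.sum_range_succ, Finset.sum_range_succ, Finset.sum_range_succ, Finset.sum_range_succ,
      Finset.sum_eq_zero (fun j hj => by
        rw [Fent_zero' _ _ _ _ _ _ _ _ (by have := Finset.mem_range.1 hj; omega), zero_mul])]
    rw [Finset.sum_range_succ _ (m + 3), Finset.sum_range_succ _ (m + 2),
      Finset.sum_range_succ _ (m + 1)]
    generalize ∑ k ∈ range (m + 1), α k * q k * t ^ k = s
    simp [Fent]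
    norm_num [add_assoc] at e ⊢
    field_simp
    linear_combination (-t^(m+3) * α (m+1) * α (m+2) * α (m+3)) * e

lemma det_formula (a b c α q : ℕ → ℝ) (x t : ℝ) (hα : ∀ n, α n ≠ 0) (hα0 : α 0 = 1)
    (hq0 : q 0 = 1)
    (hr0 : x * q 0 = a 0 * q 1 + b 0 * q 0)
    (hr : ∀ n, x * q (n + 1) = a (n + 1) * q (n + 2) + b (n + 1) * q (n + 1) + c (n + 1) * q n)
    (N : ℕ) :
    (Lmat a b c α N t - (x * t) • Mmat α N).det =
      (-1) ^ (N + 1) * (∏ k ∈ range (N + 1), a k / α (k + 1)) *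
        ∑ k ∈ range (N + 2), α k * q k * t ^ k := by
  set S : ℕ → ℝ := fun j => ∑ k ∈ range (j + 1), α k * q k * t ^ k with hS
  have hA : Lmat a b c α N t - (x * t) • Mmat α N =
      Matrix.of fun i j : Fin (N + 1) => Fent a b c α x t i j := by
    ext i j
    simp [Lmat, Mmat, Fent]
  rw [hA]
  set A : Matrix (Fin (N + 1)) (Fin (N + 1)) ℝ :=
    Matrix.of fun i j : Fin (N + 1) => Fent a b c α x t i j with hAd
  have hmul : A *ᵥ (fun j : Fin (N + 1) => S j) =
      fun i => if i = Fin.last N then -(a N / α (N + 1)) * S (N + 1) else 0 := by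
    ext i
    have h1 : (A *ᵥ (fun j : Fin (N + 1) => S j)) i
        = ∑ j ∈ range (N + 1), Fent a b c α x t i j * S j := by
      rw [Finset.sum_range]
      rfl
    have h2 := Fent_row a b c α q x t hα hr0 hr i
    have hi := i.2
    rw [h1]
    split_ifs with h
    · subst h
      rw [Finset.sum_range_succ] at h2
      simp only [Fin.val_last, Fent_sup] at h2 ⊢
      change _ + _ * S (N + 1) = 0 at h2
      linear_combination h2
    · have hlt : (i : ℕ) < N := by
        have : (i : ℕ) ≠ N := fun e => h (Fin.ext e)
        omega
      rw [← h2]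
      symm
      apply Finset.sum_subset
      · intro j hj
        simp only [Finset.mem_range] at *
        omega
      · intro j _ hj
        simp only [Finset.mem_range] at *
        rw [Fent_zero _ _ _ _ _ _ _ _ (by omega), zero_mul]
  have hdet : A.det = (A.updateCol 0 (A *ᵥ (fun j : Fin (N + 1) => S j))).det := by
    rw [← Matrix.cramer_apply, Matrix.cramer_eq_adjugate_mulVec, Matrix.mulVec_mulVec,
      Matrix.adjugate_mul, Matrix.smul_mulVec, Matrix.one_mulVec]
    simp [hS, hα0, hq0]
  rw [hdet, hmul, Matrix.det_succ_column_zero, Finset.sum_eq_single (Fin.last N)]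
  · have hsub : ((A.updateCol 0 fun i => if i = Fin.last N then -(a N / α (N + 1)) * S (N + 1)
        else 0).submatrix (Fin.last N).succAbove Fin.succ) =
        Matrix.of fun i j : Fin N => Fent a b c α x t i (j + 1) := by
      ext i j
      simp [Matrix.updateCol_apply, hAd]
    rw [hsub, Matrix.det_of_lowerTriangular]
    · simp only [Matrix.of_apply, Fent_sup, Matrix.updateCol_self, if_true]
      rw [Finset.prod_range_succ, Finset.prod_range (fun k => a k / α (k + 1)) , Fin.val_last]
      change _ = _ * S (N + 1)
      ring
    · intro i j hij
      have : (i : ℕ) < j := hij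
      exact Fent_zero _ _ _ _ _ _ _ _ (by omega)
  · intro i _ hi
    simp [hi]
  · simp

/-- for `N > n`,
`p_n(x) = ((−1)^{N+1}/(α_n·n!)) · (∏_{k=0}^{N} α_{k+1}/a_k) ·
(dⁿ/dtⁿ)|_{t=0} det(L_N(t) − x·t·M_N)`. -/
theorem recover_pn_from_det
    (a b c : ℕ → ℝ) (ha : ∀ n, a n ≠ 0)
    (p : ℕ → Polynomial ℝ)
    (hp0 : p 0 = 1)
    (hrec0 : Polynomial.X * p 0 = Polynomial.C (a 0) * p 1 + Polynomial.C (b 0) * p 0)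
    (hrec : ∀ n : ℕ, Polynomial.X * p (n + 1) =
      Polynomial.C (a (n + 1)) * p (n + 2) + Polynomial.C (b (n + 1)) * p (n + 1)
        + Polynomial.C (c (n + 1)) * p n)
    (α : ℕ → ℝ) (hα0 : α 0 = 1) (hα : ∀ n, α n ≠ 0)
    (n N : ℕ) (hN : n < N) (x : ℝ) :
    (p n).eval x =
      (-1 : ℝ) ^ (N + 1) / (α n * n.factorial) *
        (∏ k ∈ Finset.range (N + 1), α (k + 1) / a k) *
        iteratedDeriv n (fun t : ℝ => (Lmat a b c α N t - (x * t) • Mmat α N).det) 0 := by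
  have hr0 : x * (p 0).eval x = a 0 * (p 1).eval x + b 0 * (p 0).eval x := by
    simpa using congrArg (Polynomial.eval x) hrec0
  have hr : ∀ n, x * (p (n + 1)).eval x = a (n + 1) * (p (n + 2)).eval x
      + b (n + 1) * (p (n + 1)).eval x + c (n + 1) * (p n).eval x := fun n => by
    simpa using congrArg (Polynomial.eval x) (hrec n)
  set K : ℝ := (-1) ^ (N + 1) * (∏ k ∈ range (N + 1), a k / α (k + 1)) with hK
  set P : Polynomial ℝ := ∑ k ∈ range (N + 2),
    Polynomial.monomial k (K * (α k * (p k).eval x)) with hP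
  have hf : (fun t : ℝ => (Lmat a b c α N t - (x * t) • Mmat α N).det) =
      fun t => P.eval t := by
    ext t
    rw [det_formula a b c α (fun k => (p k).eval x) x t hα hα0 (by simp [hp0]) hr0 hr N, ← hK, hP,
      Polynomial.eval_finsetSum, Finset.mul_sum]
    refine Finset.sum_congr rfl fun k _ => ?_
    rw [Polynomial.eval_monomial]
    ring
  have hD : ∀ m : ℕ, iteratedDeriv m (fun t => P.eval t) =
      fun t => (Polynomial.derivative^[m] P).eval t := by
    intro m
    induction m with
    | zero => simp
    | succ m ih =>
      rw [iteratedDeriv_succ, ih]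
      ext t
      rw [Polynomial.deriv, Function.iterate_succ_apply']
  have hc : P.coeff n = K * (α n * (p n).eval x) := by
    rw [hP, Polynomial.finsetSum_coeff, Finset.sum_eq_single n]
    · simp
    · intro k _ hk
      rw [Polynomial.coeff_monomial, if_neg hk]
    · intro h
      exact absurd (Finset.mem_range.2 (by omega)) h
  rw [hf, hD]
  simp only
  rw [← Polynomial.coeff_zero_eq_eval_zero, Polynomial.coeff_iterate_derivative, zero_add, hc,
    Nat.descFactorial_self, nsmul_eq_mul, hK]
  have h1 : (∏ k ∈ Finset.range (N + 1), α (k + 1) / a k) *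
      (∏ k ∈ range (N + 1), a k / α (k + 1)) = 1 := by
    rw [← Finset.prod_mul_distrib]
    refine Finset.prod_eq_one fun k _ => ?_
    have := ha k
    have := hα (k + 1)
    field_simp
  have h2 : ((-1 : ℝ) ^ (N + 1)) * (-1) ^ (N + 1) = 1 := by
    rw [← mul_pow]; simp
  have h3 : (n.factorial : ℝ) ≠ 0 := by positivity
  have h4 := hα n
  generalize (∏ k ∈ Finset.range (N + 1), α (k + 1) / a k) = U at *
  generalize (∏ k ∈ Finset.range (N + 1), a k / α (k + 1)) = V at *
  generalize ((-1 : ℝ) ^ (N + 1)) = e at *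
  field_simp
  linear_combination (-(p n).eval x * e * e) * h1 - (p n).eval x * h2
end

section
/- For every N ∈ ℕ, every t ≠ 0 and every x ∈ ℝ, the product (J_N(t) − x·I)·B_N(x;t) has entries: ((J_N(t) − x·I)·B_N(x;t))_{i,j} = δ_{i,j} for i < N; ((J_N(t) − x·I)·B_N(x;t))_{N,N} = 0; and ((J_N(t) − x·I)·B_N(x;t))_{N,j} = −(t^{N−j}·a_N/a_j)·p_{N−j}^{(j+1)}(x) for 0 ≤ j < N. -/
open Polynomial Finset Matrix

/-- The truncated Jacobi matrix `J_N(t)`. -/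
noncomputable def Jmat (a b c : ℕ → ℝ) (N : ℕ) (t : ℝ) :
    Matrix (Fin (N + 1)) (Fin (N + 1)) ℝ :=
  Matrix.of fun i j =>
    if (j : ℕ) = (i : ℕ) then b (i : ℕ)
    else if (j : ℕ) = (i : ℕ) + 1 then a (i : ℕ) / t
    else if (i : ℕ) = (j : ℕ) + 1 then c (i : ℕ) * t
    else 0

/-- The strictly lower triangular matrix `B_N(x;t)` built from the associated
polynomials `pa k n = p_n^{(k)}`. -/
noncomputable def Bmat (a : ℕ → ℝ) (pa : ℕ → ℕ → Polynomial ℝ) (N : ℕ) (x t : ℝ) :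
    Matrix (Fin (N + 1)) (Fin (N + 1)) ℝ :=
  Matrix.of fun i j =>
    if (j : ℕ) + 1 ≤ (i : ℕ) then
      t ^ ((i : ℕ) - (j : ℕ)) / a (j : ℕ) *
        (pa ((j : ℕ) + 1) ((i : ℕ) - (j : ℕ) - 1)).eval x
    else 0

noncomputable def betaAux (a : ℕ → ℝ) (pa : ℕ → ℕ → Polynomial ℝ) (x t : ℝ) (i j : ℕ) : ℝ :=
  if j + 1 ≤ i then t ^ (i - j) / a j * (pa (j + 1) (i - j - 1)).eval x else 0

theorem row_aux (a b c : ℕ → ℝ) (pa : ℕ → ℕ → Polynomial ℝ) (N : ℕ) (x t : ℝ)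
    (i j : Fin (N + 1)) :
    ((Jmat a b c N t - x • 1) * Bmat a pa N x t) i j =
      (b i - x) * betaAux a pa x t i j
      + (if (i : ℕ) < N then a i / t * betaAux a pa x t (i + 1) j else 0)
      + (if 0 < (i : ℕ) then c i * t * betaAux a pa x t (i - 1) j else 0) := by
  have h1 : ((Jmat a b c N t - x • 1) * Bmat a pa N x t) i j =
      ∑ k : Fin (N + 1), (fun k : ℕ =>
        (if k = (i : ℕ) then (b i - x) * betaAux a pa x t k j else 0)
        + (if k = (i : ℕ) + 1 then a i / t * betaAux a pa x t k j else 0)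
        + (if 0 < (i : ℕ) then
            (if k = (i : ℕ) - 1 then c i * t * betaAux a pa x t k j else 0) else 0)) (k : ℕ) := by
    rw [Matrix.mul_apply]
    refine Finset.sum_congr rfl fun k _ => ?_
    have hB : Bmat a pa N x t k j = betaAux a pa x t k j := rfl
    rw [hB]
    beta_reduce
    generalize betaAux a pa x t k j = β
    simp only [Jmat, Matrix.sub_apply, Matrix.smul_apply, Matrix.one_apply, Matrix.of_apply,
      Fin.ext_iff, smul_eq_mul]
    split_ifs <;> first | omega | ring
  rw [h1, Fin.sum_univ_eq_sum_range
      (fun k : ℕ =>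
        (if k = (i : ℕ) then (b i - x) * betaAux a pa x t k j else 0)
        + (if k = (i : ℕ) + 1 then a i / t * betaAux a pa x t k j else 0)
        + (if 0 < (i : ℕ) then
            (if k = (i : ℕ) - 1 then c i * t * betaAux a pa x t k j else 0) else 0)),
    Finset.sum_add_distrib, Finset.sum_add_distrib]
  have hi := i.2
  congr 1
  · congr 1
    · rw [Finset.sum_ite_eq', if_pos (Finset.mem_range.2 hi)]
    · simp
  · split_ifs with h
    · rw [Finset.sum_ite_eq' , if_pos (Finset.mem_range.2 (by omega))]
    · simp

theorem rec_aux
    (a b c : ℕ → ℝ) (ha : ∀ n, a n ≠ 0)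
    (pa : ℕ → ℕ → Polynomial ℝ)
    (hpa0 : ∀ k : ℕ, pa (k + 1) 0 = 1)
    (hparec0 : ∀ k : ℕ, Polynomial.X * pa (k + 1) 0 =
      Polynomial.C (a (k + 1)) * pa (k + 1) 1 + Polynomial.C (b (k + 1)) * pa (k + 1) 0)
    (hparec : ∀ k n : ℕ, Polynomial.X * pa (k + 1) (n + 1) =
      Polynomial.C (a (n + 2 + k)) * pa (k + 1) (n + 2)
        + Polynomial.C (b (n + 2 + k)) * pa (k + 1) (n + 1)
        + Polynomial.C (c (n + 2 + k)) * pa (k + 1) n)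
    (t : ℝ) (ht : t ≠ 0) (x : ℝ) (i j : ℕ) :
    (b i - x) * betaAux a pa x t i j + a i / t * betaAux a pa x t (i + 1) j
      + (if 0 < i then c i * t * betaAux a pa x t (i - 1) j else 0) = if i = j then 1 else 0 := by
  have haj := ha j
  rcases lt_trichotomy i j with h | h | h
  · have e1 : betaAux a pa x t i j = 0 := if_neg (by omega)
    have e2 : betaAux a pa x t (i + 1) j = 0 := if_neg (by omega)
    have e3 : betaAux a pa x t (i - 1) j = 0 := if_neg (by omega)
    simp [e1, e2, e3, h.ne]
  · subst h
    have e1 : betaAux a pa x t i i = 0 := if_neg (by omega)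
    have e2 : betaAux a pa x t (i + 1) i = t / a i := by simp [betaAux, hpa0]
    have e3 : betaAux a pa x t (i - 1) i = 0 := if_neg (by omega)
    simp only [e1, e2, e3]
    simp
    field_simp
  · obtain ⟨m, rfl⟩ := Nat.exists_eq_add_of_lt h
    rw [if_pos (by omega), if_neg (by omega)]
    have e (n : ℕ) : betaAux a pa x t (j + n + 1) j
        = t ^ (n + 1) / a j * (pa (j + 1) n).eval x := by
      rw [betaAux, if_pos (by omega)]
      congr 2
      · congr 1; omega
      · congr 1; omega
    rw [e m, show j + m + 1 + 1 = j + (m + 1) + 1 by ring, e (m + 1)]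
    cases m with
    | zero =>
      have e3 : betaAux a pa x t (j + 0 + 1 - 1) j = 0 := if_neg (by omega)
      have r := congrArg (Polynomial.eval x) (hparec0 j)
      simp [hpa0] at r
      rw [e3]
      simp [hpa0]
      field_simp
      linear_combination (-t) * r
    | succ m =>
      have r := congrArg (Polynomial.eval x) (hparec j m)
      simp only [Polynomial.eval_mul, Polynomial.eval_add, Polynomial.eval_X,
        Polynomial.eval_C] at r
      rw [show j + (m + 1) + 1 - 1 = j + m + 1 by omega, e m,
        show j + (m + 1) + 1 = m + 2 + j by ring, show m + 1 + 1 = m + 2 by ring]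
      field_simp
      linear_combination (-t ^ (m + 3)) * r

/-- the entries of `(J_N(t) − x)·B_N(x;t)`: it is the identity in rows
`i < N`, its `(N,N)` entry is `0`, and its `(N,j)` entry is
`−(t^{N−j} a_N/a_j)·p_{N−j}^{(j+1)}(x)` for `j < N`. -/
theorem JB_product_entries
    (a b c : ℕ → ℝ) (ha : ∀ n, a n ≠ 0)
    (pa : ℕ → ℕ → Polynomial ℝ)
    (hpa0 : ∀ k : ℕ, pa (k + 1) 0 = 1)
    (hparec0 : ∀ k : ℕ, Polynomial.X * pa (k + 1) 0 =
      Polynomial.C (a (k + 1)) * pa (k + 1) 1 + Polynomial.C (b (k + 1)) * pa (k + 1) 0)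
    (hparec : ∀ k n : ℕ, Polynomial.X * pa (k + 1) (n + 1) =
      Polynomial.C (a (n + 2 + k)) * pa (k + 1) (n + 2)
        + Polynomial.C (b (n + 2 + k)) * pa (k + 1) (n + 1)
        + Polynomial.C (c (n + 2 + k)) * pa (k + 1) n)
    (N : ℕ) (t : ℝ) (ht : t ≠ 0) (x : ℝ) :
    (∀ i j : Fin (N + 1), (i : ℕ) < N →
        ((Jmat a b c N t - x • 1) * Bmat a pa N x t) i j = if i = j then 1 else 0) ∧
    ((Jmat a b c N t - x • 1) * Bmat a pa N x t) (Fin.last N) (Fin.last N) = 0 ∧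
    (∀ j : Fin (N + 1), (j : ℕ) < N →
        ((Jmat a b c N t - x • 1) * Bmat a pa N x t) (Fin.last N) j =
          -(t ^ (N - (j : ℕ)) * a N / a (j : ℕ)) *
            (pa ((j : ℕ) + 1) (N - (j : ℕ))).eval x) := by
  have R := rec_aux a b c ha pa hpa0 hparec0 hparec t ht x
  have L (j : Fin (N + 1)) : ((Jmat a b c N t - x • 1) * Bmat a pa N x t) (Fin.last N) j =
      (if N = (j : ℕ) then 1 else 0) - a N / t * betaAux a pa x t (N + 1) j := by
    rw [row_aux, ← R]
    simp only [Fin.val_last, lt_irrefl, if_false]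
    ring
  refine ⟨fun i j hi => ?_, ?_, fun j hj => ?_⟩
  · rw [row_aux, if_pos hi, R]
    simp only [Fin.ext_iff]
  · rw [L]
    have e2 : betaAux a pa x t (N + 1) N = t / a N := by simp [betaAux, hpa0]
    simp only [Fin.val_last, e2]
    have := ha N
    simp
    field_simp
    simp
  · rw [L, if_neg (by omega), betaAux, if_pos (by omega),
      show N + 1 - (j : ℕ) = N - j + 1 by omega, Nat.add_sub_cancel, pow_succ]
    field_simp
    ring
end

section
/- Define r_{N+1}(x;t) = −t^N · Σ_{j=0}^{N} (a_N/a_j)·p_{N−j}^{(j+1)}(x)·p_j(x), and let 𝐩_N(x;t) ∈ ℝ^{N+1} be the vector with entries t^i·p_i(x), i = 0,…,N. Then for every t ≠ 0 and x ∈ ℝ, (J_N(t) − x·I)·B_N(x;t)·𝐩_N(x;t) = 𝐩_N(x;t) + r_{N+1}(x;t)·e_N, where e_N is the last standard basis vector of ℝ^{N+1}. -/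
open Polynomial Finset Matrix

noncomputable def Saux (a : ℕ → ℝ) (p : ℕ → Polynomial ℝ) (pa : ℕ → ℕ → Polynomial ℝ) (x : ℝ)
    (i : ℕ) : ℝ :=
  ∑ j ∈ Finset.range i, (pa (j + 1) (i - j - 1)).eval x * (p j).eval x / a j

theorem Bvec_aux (a : ℕ → ℝ) (p : ℕ → Polynomial ℝ) (pa : ℕ → ℕ → Polynomial ℝ)
    (N : ℕ) (x t : ℝ) :
    (Bmat a pa N x t *ᵥ fun i : Fin (N + 1) => t ^ (i : ℕ) * (p (i : ℕ)).eval x) =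
      fun i : Fin (N + 1) => t ^ (i : ℕ) * Saux a p pa x i := by
  ext i
  simp only [Matrix.mulVec, dotProduct, Bmat, Matrix.of_apply, Saux]
  rw [Fin.sum_univ_eq_sum_range (fun j => (if j + 1 ≤ (i : ℕ) then
      t ^ ((i : ℕ) - j) / a j * (pa (j + 1) ((i : ℕ) - j - 1)).eval x else 0) *
      (t ^ j * (p j).eval x)) (N + 1), Finset.mul_sum]
  have hi := i.2
  rw [← Finset.sum_subset (s₁ := Finset.range (i : ℕ))]
  · apply Finset.sum_congr rfl
    intro j hj
    have hj' : j < (i : ℕ) := Finset.mem_range.1 hj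
    rw [if_pos (by omega)]
    have : t ^ (i : ℕ) = t ^ ((i : ℕ) - j) * t ^ j := by
      rw [← pow_add]; congr 1; omega
    rw [this]; ring
  · intro j hj
    simp only [Finset.mem_range] at *
    omega
  · intro j _ hj
    simp only [Finset.mem_range] at hj
    rw [if_neg (by omega), zero_mul]

theorem Jvec_aux (a b c : ℕ → ℝ) (N : ℕ) (x t : ℝ) (w : ℕ → ℝ) (i : Fin (N + 1)) :
    ((Jmat a b c N t - x • 1) *ᵥ (fun k : Fin (N + 1) => w k)) i =
      (b i - x) * w i + (if (i : ℕ) < N then a i / t * w (i + 1) else 0)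
        + (if 0 < (i : ℕ) then c i * t * w (i - 1) else 0) := by
  have hi := i.2
  have h : ∀ k : Fin (N + 1), (Jmat a b c N t - x • 1) i k * w k =
      (fun k : ℕ => (if k = (i : ℕ) then (b i - x) * w k else 0)
        + (if k = (i : ℕ) + 1 then a i / t * w k else 0)
        + (if k = (i : ℕ) - 1 then (if 0 < (i : ℕ) then c i * t * w k else 0) else 0)) k := by
    intro k
    simp only [Jmat, Matrix.sub_apply, Matrix.smul_apply, Matrix.of_apply, Matrix.one_apply,
      Fin.ext_iff, smul_eq_mul]
    by_cases h1 : (k : ℕ) = i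
    · by_cases h0 : 0 < (i : ℕ)
      · have : ¬ ((i : ℕ) = i - 1) := by omega
        simp [h1, this]
      · simp [h1, h0]
    · have h1' : ¬ (i : ℕ) = k := fun h => h1 h.symm
      by_cases h2 : (k : ℕ) = i + 1
      · have : ¬ ((i : ℕ) + 1 = i - 1) := by omega
        simp [h2, this]
      · by_cases h3 : (i : ℕ) = k + 1
        · have : ¬ ((k : ℕ) = k + 1 + 1) := by omega
          simp [h3, this]
        · have : ¬ ((k : ℕ) = i - 1 ∧ 0 < (i : ℕ)) := by omega
          by_cases h4 : (k : ℕ) = i - 1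
          · have h5 : ¬ 0 < (i : ℕ) := by omega
            simp only [h1, h1', h2, h3, h5, if_false]; simp
          · simp only [h1, h1', h2, h3, h4, if_false]; simp
  simp only [Matrix.mulVec, dotProduct]
  rw [Finset.sum_congr rfl (fun k _ => h k), Fin.sum_univ_eq_sum_range
      (fun k : ℕ => (if k = (i : ℕ) then (b i - x) * w k else 0)
        + (if k = (i : ℕ) + 1 then a i / t * w k else 0)
        + (if k = (i : ℕ) - 1 then (if 0 < (i : ℕ) then c i * t * w k else 0) else 0)) (N + 1),
    Finset.sum_add_distrib, Finset.sum_add_distrib, Finset.sum_ite_eq', Finset.sum_ite_eq',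
    Finset.sum_ite_eq']
  simp only [Finset.mem_range]
  rw [if_pos hi, if_pos (show (i : ℕ) - 1 < N + 1 by omega)]
  simp

theorem Srec_aux (a b c : ℕ → ℝ) (ha : ∀ n, a n ≠ 0) (p : ℕ → Polynomial ℝ)
    (pa : ℕ → ℕ → Polynomial ℝ)
    (hpa0 : ∀ k : ℕ, pa (k + 1) 0 = 1)
    (hparec0 : ∀ k : ℕ, Polynomial.X * pa (k + 1) 0 =
      Polynomial.C (a (k + 1)) * pa (k + 1) 1 + Polynomial.C (b (k + 1)) * pa (k + 1) 0)
    (hparec : ∀ k n : ℕ, Polynomial.X * pa (k + 1) (n + 1) =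
      Polynomial.C (a (n + 2 + k)) * pa (k + 1) (n + 2)
        + Polynomial.C (b (n + 2 + k)) * pa (k + 1) (n + 1)
        + Polynomial.C (c (n + 2 + k)) * pa (k + 1) n) (x : ℝ) (i : ℕ) :
    (b (i + 1) - x) * Saux a p pa x (i + 1) + a (i + 1) * Saux a p pa x (i + 2)
      + c (i + 1) * Saux a p pa x i = (p (i + 1)).eval x := by
  have key : (b (i + 1) - x) * ∑ j ∈ Finset.range i,
        (pa (j + 1) (i + 1 - j - 1)).eval x * (p j).eval x / a j
      + a (i + 1) * ∑ j ∈ Finset.range i,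
        (pa (j + 1) (i + 2 - j - 1)).eval x * (p j).eval x / a j
      + c (i + 1) * ∑ j ∈ Finset.range i,
        (pa (j + 1) (i - j - 1)).eval x * (p j).eval x / a j = 0 := by
    simp only [Finset.mul_sum, ← Finset.sum_add_distrib]
    apply Finset.sum_eq_zero
    intro j hj
    obtain ⟨m, rfl⟩ : ∃ m, i = m + 1 + j :=
      ⟨i - 1 - j, by have := Finset.mem_range.1 hj; omega⟩
    have e := congrArg (Polynomial.eval x) (hparec j m)
    simp only [Polynomial.eval_add, Polynomial.eval_mul, Polynomial.eval_X,
      Polynomial.eval_C] at e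
    rw [show m + 1 + j + 1 - j - 1 = m + 1 by omega, show m + 1 + j + 2 - j - 1 = m + 2 by omega,
      show m + 1 + j - j - 1 = m by omega, show m + 1 + j + 1 = m + 2 + j by omega]
    linear_combination (-(p j).eval x / a j) * e
  have e := congrArg (Polynomial.eval x) (hparec0 i)
  simp only [Polynomial.eval_add, Polynomial.eval_mul, Polynomial.eval_X,
      Polynomial.eval_C] at e
  have h1 : a (i + 1) * ((p (i + 1)).eval x / a (i + 1)) = (p (i + 1)).eval x := by
    field_simp [ha (i + 1)]
  simp only [Saux, Finset.sum_range_succ]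
  rw [show i + 1 - i - 1 = 0 by omega, show i + 2 - i - 1 = 1 by omega,
    show i + 2 - (i + 1) - 1 = 0 by omega]
  have h2 : (pa (i + 1 + 1) 0).eval x = 1 := by rw [hpa0]; simp
  rw [h2]
  linear_combination key + (-(p i).eval x / a i) * e + h1

/-- with `r_{N+1}(x;t) = −t^N Σ_{j=0}^N (a_N/a_j) p_{N−j}^{(j+1)}(x) p_j(x)`
and `𝐩_N(x;t) = (t^i p_i(x))_{i=0}^N`, one has
`(J_N(t) − x)·B_N(x;t)·𝐩_N(x;t) = 𝐩_N(x;t) + r_{N+1}(x;t)·e_N`. -/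
theorem JB_applied_to_pvec
    (a b c : ℕ → ℝ) (ha : ∀ n, a n ≠ 0)
    (p : ℕ → Polynomial ℝ)
    (hp0 : p 0 = 1)
    (hrec0 : Polynomial.X * p 0 = Polynomial.C (a 0) * p 1 + Polynomial.C (b 0) * p 0)
    (hrec : ∀ n : ℕ, Polynomial.X * p (n + 1) =
      Polynomial.C (a (n + 1)) * p (n + 2) + Polynomial.C (b (n + 1)) * p (n + 1)
        + Polynomial.C (c (n + 1)) * p n)
    (pa : ℕ → ℕ → Polynomial ℝ)
    (hpa0 : ∀ k : ℕ, pa (k + 1) 0 = 1)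
    (hparec0 : ∀ k : ℕ, Polynomial.X * pa (k + 1) 0 =
      Polynomial.C (a (k + 1)) * pa (k + 1) 1 + Polynomial.C (b (k + 1)) * pa (k + 1) 0)
    (hparec : ∀ k n : ℕ, Polynomial.X * pa (k + 1) (n + 1) =
      Polynomial.C (a (n + 2 + k)) * pa (k + 1) (n + 2)
        + Polynomial.C (b (n + 2 + k)) * pa (k + 1) (n + 1)
        + Polynomial.C (c (n + 2 + k)) * pa (k + 1) n)
    (N : ℕ) (t : ℝ) (ht : t ≠ 0) (x : ℝ) :
    (Jmat a b c N t - x • 1) *ᵥ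
        (Bmat a pa N x t *ᵥ fun i : Fin (N + 1) => t ^ (i : ℕ) * (p (i : ℕ)).eval x) =
      (fun i : Fin (N + 1) => t ^ (i : ℕ) * (p (i : ℕ)).eval x) +
        Pi.single (Fin.last N)
          (-t ^ N * ∑ j ∈ Finset.range (N + 1),
            a N / a j * (pa (j + 1) (N - j)).eval x * (p j).eval x) := by
  rw [Bvec_aux]
  ext i
  rw [Jvec_aux a b c N x t (fun k => t ^ k * Saux a p pa x k) i]
  have hS : ∀ n, a n * Saux a p pa x (n + 1) =
      ∑ j ∈ Finset.range (n + 1), a n / a j * (pa (j + 1) (n - j)).eval x * (p j).eval x := by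
    intro n
    rw [Saux, Finset.mul_sum]
    apply Finset.sum_congr rfl
    intro j hj
    rw [show n + 1 - j - 1 = n - j by omega]
    ring
  have hrow : (b i - x) * (t ^ (i : ℕ) * Saux a p pa x i)
      + t ^ (i : ℕ) * (a i * Saux a p pa x (i + 1))
      + (if 0 < (i : ℕ) then c i * t * (t ^ ((i : ℕ) - 1) * Saux a p pa x (i - 1)) else 0)
      = t ^ (i : ℕ) * (p i).eval x := by
    generalize (i : ℕ) = n
    rcases n with _ | n
    · simp [Saux, hpa0, hp0, ha 0]
    · have := Srec_aux a b c ha p pa hpa0 hparec0 hparec x n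
      simp only [Nat.zero_lt_succ, if_true, Nat.add_sub_cancel]
      linear_combination t ^ (n + 1) * this
  simp only [Pi.add_apply, ← hS, ← hrow]
  by_cases h : (i : ℕ) < N
  · have hne : i ≠ Fin.last N := by
      intro h'; rw [h'] at h; simp at h
    rw [Pi.single_eq_of_ne hne, if_pos h]
    have : a i / t * (t ^ ((i : ℕ) + 1) * Saux a p pa x (i + 1)) =
        t ^ (i : ℕ) * (a i * Saux a p pa x (i + 1)) := by
      field_simp
      ring
    rw [this]; ring
  · have hi : i = Fin.last N := by
      ext; have := i.2; simp; omega
    subst hi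
    rw [Pi.single_eq_same, if_neg h]
    simp only [Fin.val_last]
    ring
end

section
/- For every N ≥ 1 there exists T > 0 such that for all t > T the polynomial x ↦ q_N(x;t), which has degree N, has N real simple zeros (i.e. N pairwise distinct real roots). -/
open Polynomial Finset

lemma p_deg (a b c : ℕ → ℝ) (ha : ∀ n, a n ≠ 0)
    (p : ℕ → Polynomial ℝ)
    (hp0 : p 0 = 1)
    (hrec0 : Polynomial.X * p 0 = Polynomial.C (a 0) * p 1 + Polynomial.C (b 0) * p 0)
    (hrec : ∀ n : ℕ, Polynomial.X * p (n + 1) =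
      Polynomial.C (a (n + 1)) * p (n + 2) + Polynomial.C (b (n + 1)) * p (n + 1)
        + Polynomial.C (c (n + 1)) * p n) (n : ℕ) :
    (p n).degree = n ∧ (p (n+1)).degree = (n + 1 : ℕ) := by
  induction n with
  | zero =>
    refine ⟨by simp [hp0], ?_⟩
    have h : C (a 0) * p 1 = X - C (b 0) := by
      rw [hp0] at hrec0; linear_combination -hrec0
    have h2 := congrArg degree h
    rw [degree_C_mul (ha 0), degree_X_sub_C] at h2
    simpa using h2
  | succ n ih =>
    obtain ⟨h0, h1⟩ := ih
    refine ⟨h1, ?_⟩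
    have h : C (a (n+1)) * p (n+2) = (X - C (b (n+1))) * p (n+1) - C (c (n+1)) * p n := by
      linear_combination -hrec n
    have h2 := congrArg degree h
    have h3 : ((X - C (b (n+1))) * p (n+1)).degree = ((n + 1 + 1 : ℕ) : WithBot ℕ) := by
      rw [degree_mul, degree_X_sub_C, h1]; push_cast; ring
    rw [degree_C_mul (ha _), degree_sub_eq_left_of_degree_lt, h3] at h2
    · exact h2
    · rw [h3]
      refine lt_of_le_of_lt ((degree_mul_le _ _).trans (add_le_of_nonpos_left degree_C_le)) ?_
      rw [h0]
      exact_mod_cast (by omega)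

lemma p_wr (a b c : ℕ → ℝ) (ha : ∀ n, a n ≠ 0) (hac : ∀ n : ℕ, 0 < a n * c (n + 1))
    (p : ℕ → Polynomial ℝ)
    (hp0 : p 0 = 1)
    (hrec0 : Polynomial.X * p 0 = Polynomial.C (a 0) * p 1 + Polynomial.C (b 0) * p 0)
    (hrec : ∀ n : ℕ, Polynomial.X * p (n + 1) =
      Polynomial.C (a (n + 1)) * p (n + 2) + Polynomial.C (b (n + 1)) * p (n + 1)
        + Polynomial.C (c (n + 1)) * p n) (x : ℝ) (n : ℕ) :
    0 < a n * ((derivative (p (n+1))).eval x * (p n).eval x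
      - (derivative (p n)).eval x * (p (n+1)).eval x) := by
  induction n with
  | zero =>
    have h := congrArg (fun q => (derivative q).eval x) hrec0
    simp [hp0] at h ⊢
    linarith
  | succ n ih =>
    have h := congrArg (fun q => (derivative q).eval x) (hrec n)
    have h' := congrArg (fun q => q.eval x) (hrec n)
    simp at h h'
    set P := (p n).eval x
    set Q := (p (n+1)).eval x
    set R := (p (n+2)).eval x
    set P' := (derivative (p n)).eval x
    set Q' := (derivative (p (n+1))).eval x
    set R' := (derivative (p (n+2))).eval x
    have hc : 0 < c (n+1) / a n := by
      have : c (n+1) / a n = (a n * c (n+1)) / (a n)^2 := by field_simp [ha n]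
      rw [this]; have := ha n; have := hac n; positivity
    have key : a (n+1) * (R' * Q - Q' * R) = Q^2 + c (n+1) / a n * (a n * (Q' * P - P' * Q)) := by
      field_simp [ha n]
      linear_combination (-Q) * h + Q' * h'
    rw [key]
    have := mul_pos hc ih
    positivity

lemma p_im (a b c : ℕ → ℝ) (ha : ∀ n, a n ≠ 0) (hac : ∀ n : ℕ, 0 < a n * c (n + 1))
    (p : ℕ → Polynomial ℝ)
    (hp0 : p 0 = 1)
    (hrec0 : Polynomial.X * p 0 = Polynomial.C (a 0) * p 1 + Polynomial.C (b 0) * p 0)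
    (hrec : ∀ n : ℕ, Polynomial.X * p (n + 1) =
      Polynomial.C (a (n + 1)) * p (n + 2) + Polynomial.C (b (n + 1)) * p (n + 1)
        + Polynomial.C (c (n + 1)) * p n) (z : ℂ) (hz : z.im ≠ 0) (n : ℕ) :
    0 < z.im * (a n * ((aeval z (p (n+1))).im * (aeval z (p n)).re
      - (aeval z (p (n+1))).re * (aeval z (p n)).im)) := by
  induction n with
  | zero =>
    have h := congrArg (fun q => (aeval z q).im) hrec0
    simp [hp0] at h ⊢
    rw [← h]; exact mul_self_pos.mpr hz
  | succ n ih =>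
    have h := congrArg (fun q => (aeval z q).im) (hrec n)
    have h' := congrArg (fun q => (aeval z q).re) (hrec n)
    simp at h h'
    set P := aeval z (p n)
    set Q := aeval z (p (n+1))
    set R := aeval z (p (n+2))
    have hc : 0 < c (n+1) / a n := by
      have : c (n+1) / a n = (a n * c (n+1)) / (a n)^2 := by field_simp [ha n]
      rw [this]; have := ha n; have := hac n; positivity
    have key : z.im * (a (n+1) * (R.im * Q.re - R.re * Q.im)) =
       z.im^2 * (Q.re^2 + Q.im^2) + c (n+1) / a n * (z.im * (a n * (Q.im * P.re - Q.re * P.im))) := by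
      field_simp [ha n]
      linear_combination (-Q.re) * h + Q.im * h'
    rw [key]
    have := mul_pos hc ih
    positivity

lemma real_card (P : ℝ[X]) (h1 : ∀ z : ℂ, aeval z P = 0 → z.im = 0)
    (h2 : ∀ x : ℝ, P.eval x = 0 → (derivative P).eval x ≠ 0) :
    P.roots.toFinset.card = P.natDegree := by
  have hs : P.Splits := by
    refine Splits.of_splits_map (algebraMap ℝ ℂ) (IsAlgClosed.splits _) ?_
    intro z hz
    have hz' : aeval z P = 0 := by
      have := isRoot_of_mem_roots hz
      rwa [IsRoot, eval_map_algebraMap] at this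
    exact ⟨z.re, by apply Complex.ext <;> simp [h1 z hz']⟩
  have hP : P ≠ 0 := by
    rintro rfl; simpa using h2 0
  have hn : P.roots.Nodup := by
    rw [Multiset.nodup_iff_count_le_one]
    intro x
    rw [count_roots]
    by_contra hc
    have := (one_lt_rootMultiplicity_iff_isRoot hP).mp (not_le.mp hc)
    exact h2 x this.1 this.2
  rw [Multiset.toFinset_card_of_nodup hn]
  exact hs.natDegree_eq_card_roots.symm

lemma sign_chg (P : ℝ[X]) (r : ℝ) (h0 : P.eval r = 0) (h : (derivative P).eval r ≠ 0) :
    ∀ᶠ ε in nhdsWithin (0:ℝ) (Set.Ioi 0), P.eval (r-ε) * P.eval (r+ε) < 0 := by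
  obtain ⟨G, hG⟩ := dvd_iff_isRoot.mpr (show P.IsRoot r from h0)
  have hd : (derivative P).eval r = G.eval r := by rw [hG]; simp
  rw [hd] at h
  have hc : Continuous fun ε : ℝ => G.eval (r-ε) * G.eval (r+ε) := by fun_prop
  have h1 : ∀ᶠ ε in nhds (0:ℝ), 0 < G.eval (r-ε) * G.eval (r+ε) := by
    apply hc.continuousAt.eventually_mem (lt_mem_nhds _)
    simp only [sub_zero, add_zero]; exact mul_self_pos.mpr h
  filter_upwards [nhdsWithin_le_nhds h1, self_mem_nhdsWithin] with ε h2 h3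
  have : P.eval (r-ε) * P.eval (r+ε) = - (ε^2 * (G.eval (r-ε) * G.eval (r+ε))) := by
    rw [hG]; simp; ring
  rw [this]
  have : 0 < ε := h3
  have := mul_pos (pow_pos this 2) h2
  linarith

lemma root_in (Q : ℝ[X]) (r ε : ℝ) (hε : 0 < ε) (h : Q.eval (r-ε) * Q.eval (r+ε) < 0) :
    ∃ s, |s - r| < ε ∧ Q.eval s = 0 := by
  have hc : ContinuousOn (fun x => Q.eval x) (Set.Icc (r-ε) (r+ε)) := by fun_prop
  have hle : r - ε ≤ r + ε := by linarith
  rcases mul_neg_iff.mp h with ⟨h1, h2⟩ | ⟨h1, h2⟩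
  · obtain ⟨s, hs, h3⟩ := intermediate_value_Ioo' hle hc ⟨h2, h1⟩
    exact ⟨s, by rw [abs_lt]; constructor <;> linarith [hs.1, hs.2], h3⟩
  · obtain ⟨s, hs, h3⟩ := intermediate_value_Ioo hle hc ⟨h1, h2⟩
    exact ⟨s, by rw [abs_lt]; constructor <;> linarith [hs.1, hs.2], h3⟩

lemma q_tend (p : ℕ → ℝ[X]) (α : ℕ → ℝ) (N : ℕ) (x : ℝ) :
    Filter.Tendsto (fun t : ℝ => (∑ n ∈ Finset.range (N + 1), C (t ^ n * α n) * p n).eval x / t ^ N)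
      Filter.atTop (nhds (α N * (p N).eval x)) := by
  have hc : Continuous fun s : ℝ => ∑ n ∈ Finset.range (N + 1), s ^ (N - n) * α n * (p n).eval x := by
    fun_prop
  have h0 := (hc.tendsto 0).comp (tendsto_inv_atTop_zero (𝕜 := ℝ))
  have e : ∑ n ∈ Finset.range (N + 1), (0:ℝ) ^ (N - n) * α n * (p n).eval x = α N * (p N).eval x := by
    rw [Finset.sum_range_succ, Finset.sum_eq_zero]
    · simp
    · intro i hi
      have : N - i ≠ 0 := by have := Finset.mem_range.mp hi; omega
      simp [this]
  rw [e] at h0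
  refine h0.congr' ?_
  filter_upwards [Filter.eventually_gt_atTop 0] with t ht
  simp only [Function.comp, eval_finsetSum, Finset.sum_div, eval_mul, eval_C]
  refine Finset.sum_congr rfl fun n hn => ?_
  have : n ≤ N := by have := Finset.mem_range.mp hn; omega
  obtain ⟨k, rfl⟩ := Nat.exists_eq_add_of_le this
  rw [Nat.add_sub_cancel_left, pow_add, inv_pow]
  field_simp

theorem real_simple_zeros_for_large_t
    (a b c : ℕ → ℝ) (ha : ∀ n, a n ≠ 0) (hac : ∀ n : ℕ, 0 < a n * c (n + 1))
    (p : ℕ → Polynomial ℝ)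
    (hp0 : p 0 = 1)
    (hrec0 : Polynomial.X * p 0 = Polynomial.C (a 0) * p 1 + Polynomial.C (b 0) * p 0)
    (hrec : ∀ n : ℕ, Polynomial.X * p (n + 1) =
      Polynomial.C (a (n + 1)) * p (n + 2) + Polynomial.C (b (n + 1)) * p (n + 1)
        + Polynomial.C (c (n + 1)) * p n)
    (α : ℕ → ℝ) (hα0 : α 0 = 1) (hα : ∀ n, α n ≠ 0)
    (N : ℕ) (hN : 1 ≤ N) :
    ∃ T : ℝ, 0 < T ∧ ∀ t : ℝ, T < t →
      (∑ n ∈ Finset.range (N + 1), Polynomial.C (t ^ n * α n) * p n).degree = N ∧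
      ∃ β : Fin N → ℝ, StrictMono β ∧
        (∑ n ∈ Finset.range (N + 1), Polynomial.C (t ^ n * α n) * p n).roots =
          Multiset.map β Finset.univ.val := by
  have hdeg : ∀ n, (p n).degree = n := fun n => (p_deg a b c ha p hp0 hrec0 hrec n).1
  have hsimple : ∀ x : ℝ, (p N).eval x = 0 → (derivative (p N)).eval x ≠ 0 := by
    intro x hx hx'
    have := p_wr a b c ha hac p hp0 hrec0 hrec x N
    rw [hx, hx'] at this
    simp at this
  have hreal : ∀ z : ℂ, aeval z (p N) = 0 → z.im = 0 := by
    intro z hz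
    by_contra him
    have := p_im a b c ha hac p hp0 hrec0 hrec z him N
    rw [hz] at this
    simp at this
  have hcard := real_card (p N) hreal hsimple
  rw [natDegree_eq_of_degree_eq_some (hdeg N)] at hcard
  have hpN : p N ≠ 0 := by
    intro h; have := hdeg N; rw [h] at this; simp at this
  set Z := (p N).roots.toFinset with hZ
  have hZ0 : ∀ r ∈ Z, (p N).eval r = 0 := by
    intro r hr
    rw [hZ, Multiset.mem_toFinset, mem_roots hpN] at hr
    exact hr
  -- choose ε
  have hε : ∀ᶠ ε in nhdsWithin (0:ℝ) (Set.Ioi 0), 0 < ε ∧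
      (∀ r ∈ Z, (p N).eval (r-ε) * (p N).eval (r+ε) < 0) ∧
      (∀ r ∈ Z, ∀ s ∈ Z, r ≠ s → 2 * ε < |r - s|) := by
    refine Filter.Eventually.and self_mem_nhdsWithin (Filter.Eventually.and ?_ ?_)
    · rw [Filter.eventually_all_finset]
      exact fun r hr => sign_chg _ r (hZ0 r hr) (hsimple r (hZ0 r hr))
    · rw [Filter.eventually_all_finset]
      intro r hr
      rw [Filter.eventually_all_finset]
      intro s hs
      by_cases h : r = s
      · simp [h]
      · have : 0 < |r - s| / 2 := by have := abs_pos.mpr (sub_ne_zero.mpr h); linarith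
        filter_upwards [nhdsWithin_le_nhds (gt_mem_nhds this)] with ε h1 _
        linarith
  obtain ⟨ε, hε0, hε1, hε2⟩ := hε.exists
  have hev : ∀ᶠ t in Filter.atTop, ∀ r ∈ Z,
      (∑ n ∈ Finset.range (N + 1), C (t ^ n * α n) * p n).eval (r-ε) / t^N *
      ((∑ n ∈ Finset.range (N + 1), C (t ^ n * α n) * p n).eval (r+ε) / t^N) < 0 := by
    rw [Filter.eventually_all_finset]
    intro r hr
    refine ((q_tend p α N (r-ε)).mul (q_tend p α N (r+ε))).eventually_mem (gt_mem_nhds ?_)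
    have h1 := mul_pos_of_neg_of_neg (hε1 r hr) (by have := hα N; have : 0 < α N ^2 := by positivity
                                                    linarith : -(α N ^2) < 0)
    linarith
  obtain ⟨T, hT⟩ := Filter.eventually_atTop.mp hev
  refine ⟨max T 1, by positivity, fun t ht => ?_⟩
  have hTt := hT t ((le_max_left _ _).trans ht.le)
  have ht0 : 0 < t := lt_of_lt_of_le one_pos ((le_max_right _ _).trans ht.le)
  have hD : (∑ n ∈ Finset.range (N + 1), Polynomial.C (t ^ n * α n) * p n).degree = N := by
    have hl : (C (t ^ N * α N) * p N).degree = N := by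
      rw [degree_C_mul (mul_ne_zero (by positivity) (hα N)), hdeg]
    rw [Finset.sum_range_succ, degree_add_eq_right_of_degree_lt, hl]
    rw [hl]
    refine lt_of_le_of_lt (degree_sum_le _ _) ?_
    rw [Finset.sup_lt_iff (WithBot.bot_lt_coe _)]
    intro n hn
    refine lt_of_le_of_lt ((degree_mul_le _ _).trans (add_le_of_nonpos_left degree_C_le)) ?_
    rw [hdeg]
    exact_mod_cast Finset.mem_range.mp hn
  refine ⟨hD, ?_⟩
  set Q := ∑ n ∈ Finset.range (N + 1), Polynomial.C (t ^ n * α n) * p n with hQ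
  have hQ0 : Q ≠ 0 := by
    intro h; rw [h] at hD; simp at hD
  have hroot : ∀ r ∈ Z, ∃ s, |s - r| < ε ∧ Q.eval s = 0 := by
    intro r hr
    apply root_in Q r ε hε0
    have h1 := hTt r hr
    rw [div_mul_div_comm, div_neg_iff] at h1
    have : 0 < t^N * t^N := by positivity
    rcases h1 with h1 | h1
    · linarith [h1.2]
    · exact h1.1
  choose! f hf1 hf2 using hroot
  have hle : Z.card ≤ Q.roots.toFinset.card := by
    apply Finset.card_le_card_of_injOn f
    · intro r hr
      simp only [Finset.mem_coe, Multiset.mem_toFinset, mem_roots hQ0]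
      exact hf2 r hr
    · intro r hr s hs hrs
      by_contra hne
      have h1 := hε2 r hr s hs hne
      have h2 := hf1 r hr
      have h3 := hf1 s hs
      rw [← hrs] at h3
      have := abs_sub_le r (f r) s
      rw [abs_sub_comm r (f r)] at this
      linarith
  have hup : Multiset.card Q.roots ≤ N := by
    have := card_roots' Q
    rwa [natDegree_eq_of_degree_eq_some hD] at this
  have hle2 := Multiset.toFinset_card_le Q.roots
  have hnd : Q.roots.Nodup := by
    rw [← Multiset.toFinset_card_eq_card_iff_nodup]; omega
  have hcc : Q.roots.toFinset.card = N := by omega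
  refine ⟨Q.roots.toFinset.orderEmbOfFin hcc, OrderEmbedding.strictMono _, ?_⟩
  have h1 := Finset.map_orderEmbOfFin_univ Q.roots.toFinset hcc
  have h2 := congrArg Finset.val h1
  rw [Multiset.toFinset_val, hnd.dedup] at h2
  exact h2.symm
end

section
/- For every N ≥ 1 there exists T > 0 such that for all t > T the polynomials x ↦ q_N(x;t) and x ↦ q_{N+1}(x;t) have only real simple zeros β_1 < β_2 < … < β_N and γ_1 < γ_2 < … < γ_{N+1} respectively, and these zeros interlace: γ_i < β_i < γ_{i+1} for all 1 ≤ i ≤ N. -/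
open Polynomial Finset

lemma aux_alt (k : ℕ) (A B : ℝ) (hA : 0 < (-1 : ℝ) ^ k * A) (hB : 0 < (-1 : ℝ) ^ (k + 1) * B) :
    A * B < 0 := by
  rcases neg_one_pow_eq_or ℝ k with h | h
  · rw [pow_succ, h] at hB
    rw [h] at hA
    nlinarith
  · rw [pow_succ, h] at hB
    rw [h] at hA
    nlinarith

lemma aux_sgn (w : ℕ → ℝ) (x : ℝ) (m j : ℕ) (hj : j ≤ m) (h1 : ∀ i, i < j → w i < x)
    (h2 : ∀ i, j ≤ i → i < m → x < w i) :
    0 < (-1 : ℝ) ^ (m + j) * (∏ i ∈ range m, (X - C (w i))).eval x := by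
  rw [eval_prod]
  simp only [eval_sub, eval_X, eval_C]
  induction m, hj using Nat.le_induction with
  | base =>
    rw [← two_mul, pow_mul]
    norm_num
    exact prod_pos fun i hi => sub_pos.2 (h1 i (mem_range.1 hi))
  | succ m hm ih =>
    have := ih (fun i hi hi' => h2 i hi (by omega))
    have h3 := h2 m hm (by omega)
    rw [prod_range_succ]
    have h4 : (-1 : ℝ) ^ (m + 1 + j) * ((∏ i ∈ range m, (x - w i)) * (x - w m)) =
      ((-1 : ℝ) ^ (m + j) * (∏ i ∈ range m, (x - w i))) * (w m - x) := by
      rw [show m + 1 + j = m + j + 1 by ring, pow_succ]; ring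
    rw [h4]
    exact mul_pos this (sub_pos.2 h3)

lemma aux_ivt (P : ℝ[X]) (x y : ℝ) (hxy : x < y) (h : P.eval x * P.eval y < 0) :
    ∃ r, x < r ∧ r < y ∧ P.eval r = 0 := by
  have hc : ContinuousOn (fun u => P.eval u) (Set.Icc x y) := P.continuous.continuousOn
  rcases mul_neg_iff.1 h with ⟨h1, h2⟩ | ⟨h1, h2⟩
  · obtain ⟨r, hr, hr'⟩ := intermediate_value_Ioo' hxy.le hc ⟨h2, h1⟩
    exact ⟨r, hr.1, hr.2, hr'⟩
  · obtain ⟨r, hr, hr'⟩ := intermediate_value_Ioo hxy.le hc ⟨h1, h2⟩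
    exact ⟨r, hr.1, hr.2, hr'⟩

lemma aux_mono (w : ℕ → ℝ) (n : ℕ) (h : ∀ i < n, w i < w (i + 1)) (i j : ℕ) (hij : i ≤ j)
    (hj : j ≤ n) : w i ≤ w j := by
  induction j, hij using Nat.le_induction with
  | base => exact le_rfl
  | succ j hm ih => exact (ih (by omega)).trans (h j (by omega)).le

lemma aux_smono (w : ℕ → ℝ) (n : ℕ) (h : ∀ i < n, w i < w (i + 1)) :
    StrictMono (fun i : Fin (n + 1) => w i) := by
  intro i j hij
  have h1 : (i : ℕ) < j := hij
  exact (h i (by omega)).trans_le (aux_mono w n h (i + 1) j h1 (by omega))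

lemma aux_roots (P : ℝ[X]) (m : ℕ) (hP : P.degree = m) (f : Fin m → ℝ) (hf : StrictMono f)
    (h : ∀ i, P.eval (f i) = 0) : P.roots = Multiset.map f Finset.univ.val := by
  have h0 : P ≠ 0 := by rintro rfl; simp at hP
  symm
  apply Multiset.eq_of_le_of_card_le
  · rw [Multiset.le_iff_subset (Multiset.Nodup.map hf.injective Finset.univ.nodup)]
    intro x hx
    obtain ⟨i, _, rfl⟩ := Multiset.mem_map.1 hx
    exact (mem_roots h0).2 (h i)
  · have := P.card_roots'
    rw [natDegree_eq_of_degree_eq_some hP] at this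
    simpa using this

lemma aux_fact (P : ℝ[X]) (m : ℕ) (hP : P.Monic) (hd : P.natDegree = m) (w : ℕ → ℝ)
    (hw : StrictMono (fun i : Fin m => w i)) (h : ∀ i < m, P.eval (w i) = 0) :
    P = ∏ i ∈ range m, (X - C (w i)) := by
  have hd' : P.degree = m := by rw [degree_eq_natDegree hP.ne_zero, hd]
  have hr := aux_roots P m hd' _ hw (fun i => h i i.2)
  have := prod_multiset_X_sub_C_of_monic_of_roots_card_eq hP (by rw [hr, hd]; simp)
  rw [hr, Multiset.map_map] at this
  rw [← this]
  exact Fin.prod_univ_eq_prod_range (fun i => X - C (w i)) m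

lemma aux_top (P : ℝ[X]) (hP : P.Monic) (hd : 0 < P.natDegree) (y : ℝ) :
    ∃ x, y < x ∧ 0 < P.eval x := by
  have := P.tendsto_atTop_of_leadingCoeff_nonneg (natDegree_pos_iff_degree_pos.1 hd)
    (by rw [hP.leadingCoeff]; norm_num)
  obtain ⟨x, hx⟩ := ((Filter.eventually_gt_atTop y).and (this.eventually_gt_atTop 0)).exists
  exact ⟨x, hx⟩

lemma aux_bot (P : ℝ[X]) (hP : P.Monic) (hd : 0 < P.natDegree) (y : ℝ) :
    ∃ x, x < y ∧ 0 < (-1 : ℝ) ^ P.natDegree * P.eval x := by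
  have hnd : (C ((-1 : ℝ) ^ P.natDegree) * P.comp (-X)).natDegree = P.natDegree := by
    rw [natDegree_C_mul (by simp), natDegree_comp]; simp
  obtain ⟨x, h1, h2⟩ := aux_top (C ((-1 : ℝ) ^ P.natDegree) * P.comp (-X)) (by
    rw [Monic, leadingCoeff_mul, leadingCoeff_comp (by simp)]
    simp [hP.leadingCoeff, ← mul_pow]) (by rw [hnd]; exact hd) (-y)
  exact ⟨-x, by linarith, by simpa using h2⟩

lemma aux_monic (P : ℕ → ℝ[X]) (b l : ℕ → ℝ) (h0 : P 0 = 1) (h1 : P 1 = X - C (b 0))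
    (hr : ∀ n, P (n + 2) = (X - C (b (n + 1))) * P (n + 1) - C (l n) * P n) (n : ℕ) :
    ((P n).Monic ∧ (P n).natDegree = n) ∧ ((P (n + 1)).Monic ∧ (P (n + 1)).natDegree = n + 1) := by
  induction n with
  | zero =>
    rw [h0, h1]
    exact ⟨⟨monic_one, natDegree_one⟩, monic_X_sub_C _, natDegree_X_sub_C _⟩
  | succ n ih =>
    refine ⟨ih.2, ?_⟩
    obtain ⟨⟨m1, d1⟩, m2, d2⟩ := ih
    have hm : ((X - C (b (n + 1))) * P (n + 1)).Monic := (monic_X_sub_C _).mul m2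
    have hd : ((X - C (b (n + 1))) * P (n + 1)).natDegree = n + 2 := by
      rw [(monic_X_sub_C _).natDegree_mul m2, natDegree_X_sub_C, d2]; ring
    have hlt : (C (l n) * P n).natDegree < ((X - C (b (n + 1))) * P (n + 1)).natDegree := by
      rw [hd]
      have := natDegree_C_mul_le (l n) (P n)
      omega
    have hlt' := degree_lt_degree hlt
    rw [show n + 1 + 1 = n + 2 by rfl, hr]
    refine ⟨hm.sub_of_left hlt', ?_⟩
    rw [natDegree_sub_eq_left_of_natDegree_lt hlt, hd]

lemma aux_inter (P : ℕ → ℝ[X]) (b l : ℕ → ℝ) (hl : ∀ n, 0 < l n)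
    (h0 : P 0 = 1) (h1 : P 1 = X - C (b 0))
    (hr : ∀ n, P (n + 2) = (X - C (b (n + 1))) * P (n + 1) - C (l n) * P n) (n : ℕ) :
    ∃ w z : ℕ → ℝ, P (n + 1) = ∏ i ∈ range (n + 1), (X - C (w i)) ∧
      P n = ∏ i ∈ range n, (X - C (z i)) ∧ ∀ i < n, w i < z i ∧ z i < w (i + 1) := by
  induction n with
  | zero => exact ⟨fun _ => b 0, fun _ => 0, by simp [h1], by simp [h0], by simp⟩
  | succ n ih =>
    obtain ⟨w, z, hw, hz, hi⟩ := ih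
    have hs : ∀ i < n, w i < w (i + 1) := fun i h => (hi i h).1.trans (hi i h).2
    have hm := aux_mono w n hs
    obtain ⟨-, m2, d2⟩ := aux_monic P b l h0 h1 hr (n + 1)
    rw [show n + 1 + 1 = n + 2 by rfl] at *
    obtain ⟨lo, hlo, hlo'⟩ := aux_bot (P (n + 2)) m2 (by omega) (w 0)
    obtain ⟨hi', hhi, hhi'⟩ := aux_top (P (n + 2)) m2 (by omega) (w n)
    rw [d2] at hlo'
    let e : ℕ → ℝ := fun j => Nat.casesOn j lo (fun j => if j ≤ n then w j else hi')
    have e0 : e 0 = lo := rfl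
    have e1 : ∀ j ≤ n, e (j + 1) = w j := fun j hj => if_pos hj
    have e2 : e (n + 2) = hi' := if_neg (by omega)
    have hsg : ∀ j ≤ n + 2, 0 < (-1 : ℝ) ^ (n + 2 + j) * (P (n + 2)).eval (e j) := by
      intro j hj
      rcases Nat.eq_zero_or_pos j with rfl | hj0
      · rw [e0]; exact hlo'
      · obtain ⟨j, rfl⟩ : ∃ k, j = k + 1 := ⟨j - 1, by omega⟩
        by_cases hjn : j ≤ n
        · rw [e1 j hjn, hr]
          have hwz : (P (n + 1)).eval (w j) = 0 := by
            rw [hw, eval_prod]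
            exact prod_eq_zero (mem_range.2 (by omega : j < n + 1)) (by simp)
          have hsn := aux_sgn z (w j) n j hjn
            (fun i hij => (hi i (by omega)).2.trans_le (hm _ _ hij hjn))
            (fun i hij hin => (hm _ _ hij (by omega)).trans_lt (hi i hin).1)
          rw [← hz] at hsn
          simp only [eval_sub, eval_mul, hwz, eval_C, mul_zero, zero_sub]
          have := mul_pos (hl n) hsn
          have h5 : (-1 : ℝ) ^ (n + 2 + (j + 1)) = - (-1 : ℝ) ^ (n + j) := by
            rw [show n + 2 + (j + 1) = n + j + 3 by ring, pow_add]; norm_num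
          rw [h5]
          linarith
        · obtain rfl : j = n + 1 := by omega
          rw [show n + 1 + 1 = n + 2 by rfl, e2, ← two_mul, pow_mul]
          simpa using hhi'
    have hes : ∀ j < n + 2, e j < e (j + 1) := by
      intro j hj
      rcases Nat.eq_zero_or_pos j with rfl | hj0
      · rw [e0, e1 0 (by omega)]; exact hlo
      · obtain ⟨j, rfl⟩ : ∃ k, j = k + 1 := ⟨j - 1, by omega⟩
        by_cases hjn : j + 1 ≤ n
        · rw [e1 _ hjn, e1 j (by omega)]; exact hs j (by omega)
        · obtain rfl : j = n := by omega
          rw [e2, e1 _ le_rfl]; exact hhi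
    have hex : ∀ j, ∃ r, j < n + 2 → e j < r ∧ r < e (j + 1) ∧ (P (n + 2)).eval r = 0 := by
      intro j
      by_cases hj : j < n + 2
      · obtain ⟨r, hr⟩ := aux_ivt (P (n + 2)) _ _ (hes j hj)
          (aux_alt _ _ _ (hsg j hj.le) (hsg (j + 1) hj))
        exact ⟨r, fun _ => hr⟩
      · exact ⟨0, fun h => absurd h hj⟩
    choose v hv using hex
    have hin : ∀ i < n + 1, v i < w i ∧ w i < v (i + 1) := by
      intro i h
      rw [← e1 i (by omega)]
      exact ⟨(hv i (by omega)).2.1, (hv (i + 1) (by omega)).1⟩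
    refine ⟨v, w, ?_, hw, hin⟩
    exact aux_fact _ _ m2 d2 v (aux_smono v (n + 1) fun i h => (hin i h).1.trans (hin i h).2)
      fun i h => (hv i h).2.2

lemma aux_eval (p : ℕ → ℝ[X]) (α : ℕ → ℝ) (hα : ∀ n, α n ≠ 0) (m : ℕ) (x : ℝ) :
    Filter.Tendsto (fun t : ℝ =>
      (∑ n ∈ range (m + 1), C (t ^ n * α n) * p n).eval x / t ^ m) Filter.atTop
      (nhds (α m * (p m).eval x)) := by
  have h1 : Filter.Tendsto (fun t : ℝ => (∑ n ∈ range m, (t ^ n / t ^ m) * (α n * (p n).eval x))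
      + α m * (p m).eval x) Filter.atTop
      (nhds ((∑ n ∈ range m, 0 * (α n * (p n).eval x)) + α m * (p m).eval x)) := by
    refine Filter.Tendsto.add (tendsto_finsetSum _ fun n hn => ?_) tendsto_const_nhds
    exact (tendsto_pow_div_pow_atTop_zero (mem_range.1 hn)).mul_const _
  simp only [zero_mul, sum_const_zero, zero_add] at h1
  refine h1.congr' ?_
  filter_upwards [Filter.eventually_gt_atTop 0] with t ht
  rw [eval_finsetSum, sum_div, sum_range_succ]
  have : t ^ m ≠ 0 := by positivity
  congr 1
  · refine sum_congr rfl fun n _ => ?_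
    simp only [eval_mul, eval_C]; ring
  · simp only [eval_mul, eval_C]; field_simp

lemma aux_pert (p : ℕ → ℝ[X]) (α : ℕ → ℝ) (hα : ∀ n, α n ≠ 0) (m : ℕ) (x y : ℝ)
    (h : (p m).eval x * (p m).eval y < 0) :
    ∀ᶠ t : ℝ in Filter.atTop, (∑ n ∈ range (m + 1), C (t ^ n * α n) * p n).eval x *
      (∑ n ∈ range (m + 1), C (t ^ n * α n) * p n).eval y < 0 := by
  have h1 := (aux_eval p α hα m x).mul (aux_eval p α hα m y)
  have h2 : α m * (p m).eval x * (α m * (p m).eval y) < 0 := by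
    have : 0 < α m ^ 2 := by have := hα m; positivity
    nlinarith
  filter_upwards [h1.eventually_lt_const h2, Filter.eventually_gt_atTop 0] with t ht ht0
  rw [div_mul_div_comm] at ht
  have : 0 < t ^ m * t ^ m := by positivity
  by_contra hc
  push Not at hc
  exact absurd ht (not_lt.2 (div_nonneg hc this.le))

lemma aux_deg (p : ℕ → ℝ[X]) (α : ℕ → ℝ) (hα : ∀ n, α n ≠ 0) (hp : ∀ n, (p n).degree = n)
    (m : ℕ) (t : ℝ) (ht : 0 < t) :
    (∑ n ∈ range (m + 1), C (t ^ n * α n) * p n).degree = m := by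
  have hd : ∀ n, (C (t ^ n * α n) * p n).degree = n := fun n => by
    rw [degree_C_mul (mul_ne_zero (by positivity) (hα n)), hp]
  rw [sum_range_succ, degree_add_eq_right_of_degree_lt, hd]
  rw [hd]
  refine (degree_sum_le _ _).trans_lt ?_
  rw [Finset.sup_lt_iff (by exact WithBot.bot_lt_coe m)]
  intro n hn
  rw [hd]
  exact_mod_cast mem_range.1 hn

/-- for every `N ≥ 1` there exists `T > 0` such that for all `t > T`
the polynomials `x ↦ q_N(x;t)` and `x ↦ q_{N+1}(x;t)` have only real simple zeros
`β_1 < … < β_N` and `γ_1 < … < γ_{N+1}`, and these interlace: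
`γ_i < β_i < γ_{i+1}` for all `i`. -/
theorem interlacing_partial_sums_for_large_t
    (a b c : ℕ → ℝ) (ha : ∀ n, a n ≠ 0) (hac : ∀ n : ℕ, 0 < a n * c (n + 1))
    (p : ℕ → Polynomial ℝ)
    (hp0 : p 0 = 1)
    (hrec0 : Polynomial.X * p 0 = Polynomial.C (a 0) * p 1 + Polynomial.C (b 0) * p 0)
    (hrec : ∀ n : ℕ, Polynomial.X * p (n + 1) =
      Polynomial.C (a (n + 1)) * p (n + 2) + Polynomial.C (b (n + 1)) * p (n + 1)
        + Polynomial.C (c (n + 1)) * p n)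
    (α : ℕ → ℝ) (hα0 : α 0 = 1) (hα : ∀ n, α n ≠ 0)
    (N : ℕ) (hN : 1 ≤ N) :
    ∃ T : ℝ, 0 < T ∧ ∀ t : ℝ, T < t →
      ∃ (β : Fin N → ℝ) (γ : Fin (N + 1) → ℝ),
        StrictMono β ∧ StrictMono γ ∧
        (∑ n ∈ Finset.range (N + 1), Polynomial.C (t ^ n * α n) * p n).degree = N ∧
        (∑ n ∈ Finset.range (N + 1), Polynomial.C (t ^ n * α n) * p n).roots =
          Multiset.map β Finset.univ.val ∧
        (∑ n ∈ Finset.range (N + 2), Polynomial.C (t ^ n * α n) * p n).degree = (N + 1 : ℕ) ∧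
        (∑ n ∈ Finset.range (N + 2), Polynomial.C (t ^ n * α n) * p n).roots =
          Multiset.map γ Finset.univ.val ∧
        ∀ i : Fin N, γ i.castSucc < β i ∧ β i < γ i.succ := by
  let A : ℕ → ℝ := fun n => ∏ i ∈ range n, a i
  have hA : ∀ n, A n ≠ 0 := fun n => prod_ne_zero_iff.2 fun i _ => ha i
  have hA1 : ∀ n, A (n + 1) = A n * a n := fun n => prod_range_succ _ _
  let P : ℕ → ℝ[X] := fun n => C (A n) * p n
  have hP : ∀ n, P n = C (A n) * p n := fun n => rfl
  have hP0 : P 0 = 1 := by simp [P, A, hp0]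
  have hP1 : P 1 = X - C (b 0) := by
    rw [hp0] at hrec0
    simp only [P, A, prod_range_one]
    linear_combination -hrec0
  have hPr : ∀ n, P (n + 2) = (X - C (b (n + 1))) * P (n + 1) - C (a n * c (n + 1)) * P n := by
    intro n
    simp only [hP]
    rw [hA1 (n + 1), hA1 n]
    simp only [C_mul]
    linear_combination (-C (A n) * C (a n)) * hrec n
  have hpd : ∀ n, (p n).degree = n := by
    intro n
    obtain ⟨⟨h1, h2⟩, -⟩ := aux_monic P b _ hP0 hP1 hPr n
    rw [← degree_C_mul (hA n), ← hP, degree_eq_natDegree h1.ne_zero, h2]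
  obtain ⟨w, z', hw, hz', hi'⟩ := aux_inter P b _ hac hP0 hP1 hPr N
  obtain ⟨z, hz, hi, hzN⟩ : ∃ z : ℕ → ℝ, P N = ∏ i ∈ range N, (X - C (z i)) ∧
      (∀ i < N, w i < z i ∧ z i < w (i + 1)) ∧ w N < z N := by
    refine ⟨fun i => if i < N then z' i else w N + 1, ?_, ?_, ?_⟩
    · rw [hz']
      refine prod_congr rfl fun i h => ?_
      simp only [if_pos (mem_range.1 h)]
    · intro i h
      simp only [if_pos h]
      exact hi' i h
    · simp
  have hwz : ∀ i ≤ N, w i < z i := by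
    intro i h
    rcases h.lt_or_eq with h | rfl
    · exact (hi i h).1
    · exact hzN
  have hwm := aux_mono w N fun i h => (hi i h).1.trans (hi i h).2
  have hzm := aux_mono z N fun i h => (hi i h).2.trans (hwz (i + 1) h)
  let R : ℕ → ℝ := fun i => (w i + z i) / 2
  let L : ℕ → ℝ := fun i => Nat.casesOn i (w 0 - 1) (fun i => (z i + w (i + 1)) / 2)
  have hR : ∀ i ≤ N, w i < R i ∧ R i < z i := by
    intro i h
    have := hwz i h
    constructor <;> simp only [R] <;> linarith
  have hL : ∀ i < N, z i < L (i + 1) ∧ L (i + 1) < w (i + 1) := by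
    intro i h
    have := (hi i h).2
    constructor <;> simp only [L] <;> linarith
  have hL0 : L 0 < w 0 := sub_one_lt (w 0)
  have hLw : ∀ i ≤ N, L i < w i := by
    intro i h
    rcases i with _ | i
    · exact hL0
    · exact (hL i h).2
  have hwL : ∀ k i, k < i → i ≤ N → z k < L i := by
    intro k i hk h
    obtain ⟨i, rfl⟩ : ∃ j, i = j + 1 := ⟨i - 1, by omega⟩
    exact (hzm k i (by omega) (by omega)).trans_lt (hL i h).1
  have hpP : ∀ m x y, (P m).eval x * (P m).eval y < 0 → (p m).eval x * (p m).eval y < 0 := by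
    intro m x y h
    simp only [hP, eval_mul, eval_C] at h
    have h2 : 0 < A m ^ 2 := by have := hA m; positivity
    by_contra hc
    push Not at hc
    nlinarith [mul_nonneg h2.le hc]
  have hQ : ∀ i ≤ N, (p (N + 1)).eval (L i) * (p (N + 1)).eval (R i) < 0 := by
    intro i h
    apply hpP
    rw [hw]
    refine aux_alt (N + 1 + i) _ _ (aux_sgn w (L i) _ i (by omega) ?_ ?_)
      (aux_sgn w (R i) _ (i + 1) (by omega) ?_ ?_)
    · intro k hk
      exact (hwz k (by omega)).trans (hwL k i hk h)
    · intro k hk hk'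
      exact (hLw i h).trans_le (hwm i k hk (by omega))
    · intro k hk
      exact (hwm k i (by omega) h).trans_lt (hR i h).1
    · intro k hk hk'
      exact ((hR i h).2.trans (hi i (by omega)).2).trans_le (hwm (i + 1) k hk (by omega))
  have hq : ∀ i < N, (p N).eval (R i) * (p N).eval (L (i + 1)) < 0 := by
    intro i h
    apply hpP
    rw [hz]
    refine aux_alt (N + i) _ _ (aux_sgn z (R i) _ i (by omega) ?_ ?_)
      (aux_sgn z (L (i + 1)) _ (i + 1) (by omega) ?_ ?_)
    · intro k hk
      exact ((hi k (by omega)).2.trans_le (hwm (k + 1) i hk h.le)).trans (hR i h.le).1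
    · intro k hk hk'
      exact (hR i h.le).2.trans_le (hzm i k hk (by omega))
    · intro k hk
      exact hwL k (i + 1) hk h
    · intro k hk hk'
      exact (hL i h).2.trans ((hwz (i + 1) h).trans_le (hzm (i + 1) k hk (by omega)))
  have E1 : ∀ᶠ t : ℝ in Filter.atTop, ∀ i ∈ range (N + 1),
      (∑ n ∈ range (N + 2), C (t ^ n * α n) * p n).eval (L i) *
      (∑ n ∈ range (N + 2), C (t ^ n * α n) * p n).eval (R i) < 0 :=
    (Filter.eventually_all_finset _).2 fun i h =>
      aux_pert p α hα (N + 1) _ _ (hQ i (by have := mem_range.1 h; omega))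
  have E2 : ∀ᶠ t : ℝ in Filter.atTop, ∀ i ∈ range N,
      (∑ n ∈ range (N + 1), C (t ^ n * α n) * p n).eval (R i) *
      (∑ n ∈ range (N + 1), C (t ^ n * α n) * p n).eval (L (i + 1)) < 0 :=
    (Filter.eventually_all_finset _).2 fun i h =>
      aux_pert p α hα N _ _ (hq i (mem_range.1 h))
  obtain ⟨T, hT⟩ := Filter.eventually_atTop.1 (E1.and E2)
  refine ⟨max T 1, by positivity, fun t ht => ?_⟩
  obtain ⟨F1, F2⟩ := hT t ((le_max_left _ _).trans ht.le)
  have ht0 : 0 < t := lt_trans one_pos ((le_max_right _ _).trans_lt ht)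
  have G1 : ∀ i : Fin (N + 1), ∃ r, L i < r ∧ r < R i ∧
      (∑ n ∈ range (N + 2), C (t ^ n * α n) * p n).eval r = 0 := fun i =>
    aux_ivt _ _ _ ((hLw i (by omega)).trans (hR i (by omega)).1) (F1 i (mem_range.2 i.2))
  have G2 : ∀ i : Fin N, ∃ r, R i < r ∧ r < L (i + 1) ∧
      (∑ n ∈ range (N + 1), C (t ^ n * α n) * p n).eval r = 0 := fun i =>
    aux_ivt _ _ _ ((hR i (by omega)).2.trans (hL i i.2).1) (F2 i (mem_range.2 i.2))
  choose γ hγ using G1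
  choose β hβ using G2
  have hint : ∀ i : Fin N, γ i.castSucc < β i ∧ β i < γ i.succ := fun i =>
    ⟨(hγ i.castSucc).2.1.trans (hβ i).1, (hβ i).2.1.trans (hγ i.succ).1⟩
  have hγm : StrictMono γ := Fin.strictMono_iff_lt_succ.2 fun i => (hint i).1.trans (hint i).2
  have hβm : StrictMono β := by
    intro i j hij
    refine (hint i).2.trans_le (le_trans (hγm.monotone ?_) (hint j).1.le)
    rw [Fin.le_def]
    simpa using hij
  have D1 := aux_deg p α hα hpd N t ht0
  have D2 := aux_deg p α hα hpd (N + 1) t ht0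
  exact ⟨β, γ, hβm, hγm, D1, aux_roots _ _ D1 β hβm fun i => (hβ i).2.2, D2,
    aux_roots _ _ D2 γ hγm fun i => (hγ i).2.2, hint⟩
end

section
/- For every N ≥ 1 there exists T > 0 such that for all t > T: (i) the zeros β_1 < … < β_N of x ↦ q_N(x;t) are all real and simple and interlace with the zeros x_1^{N+1} < … < x_{N+1}^{N+1} of p_{N+1}, namely x_i^{N+1} < β_i < x_{i+1}^{N+1} for 1 ≤ i ≤ N; and (ii) the zeros γ_1 < … < γ_{N+1} of x ↦ q_{N+1}(x;t) are all real and simple and interlace with the zeros x_1^N < … < x_N^N of p_N, namely γ_i < x_i^N < γ_{i+1} for 1 ≤ i ≤ N. -/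
open Polynomial Finset

lemma aux_large (m : ℕ) : ∀ d : ℕ → ℝ, 0 < d m → ∃ ε > 0, ∀ᶠ t : ℝ in Filter.atTop,
    ε ≤ ∑ n ∈ Finset.range (m + 1), t ^ n * d n := by
  induction m with
  | zero => intro d hd; exact ⟨d 0, hd, by simp⟩
  | succ m ih =>
    intro d hd
    obtain ⟨ε, hε, h⟩ := ih (fun n => d (n + 1)) hd
    refine ⟨1, one_pos, ?_⟩
    filter_upwards [h, Filter.eventually_ge_atTop ((|d 0| + 1) / ε)] with t ht ht2
    rw [Finset.sum_range_succ']
    have e : ∑ k ∈ Finset.range (m + 1), t ^ (k + 1) * d (k + 1)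
        = t * ∑ k ∈ Finset.range (m + 1), t ^ k * d (k + 1) := by
      rw [Finset.mul_sum]; exact Finset.sum_congr rfl fun k _ => by ring
    rw [e]
    have h1 : |d 0| + 1 ≤ t * ε := (div_le_iff₀ hε).1 ht2
    have h0 : 0 ≤ t := le_trans (by positivity) ht2
    have h2 := mul_le_mul_of_nonneg_left ht h0
    have h3 := neg_abs_le (d 0)
    simp only [pow_zero, one_mul]
    linarith

lemma aux_roots_s12 (m : ℕ) (q : Polynomial ℝ) (hq : q.degree = m) (y : Fin (m + 1) → ℝ)
    (hy : StrictMono y) (s : ℝ) (hs : ∀ i : Fin (m + 1), 0 < s * (-1) ^ (i : ℕ) * q.eval (y i)) :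
    ∃ β : Fin m → ℝ, StrictMono β ∧ q.roots = Multiset.map β Finset.univ.val ∧
      ∀ i : Fin m, y i.castSucc < β i ∧ β i < y i.succ := by
  have hq0 : q ≠ 0 := by rintro rfl; simp at hq
  have key : ∀ i : Fin m, ∃ z, (y i.castSucc < z ∧ z < y i.succ) ∧ q.eval z = 0 := by
    intro i
    have hlt : y i.castSucc < y i.succ := hy Fin.castSucc_lt_succ
    have h1 := hs i.castSucc
    have h2 := hs i.succ
    simp only [Fin.val_castSucc, Fin.val_succ, pow_succ] at h1 h2
    have hc : ContinuousOn (fun x => s * (-1) ^ (i : ℕ) * q.eval x)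
        (Set.Icc (y i.castSucc) (y i.succ)) := by fun_prop
    have := intermediate_value_Ioo' hlt.le hc
    obtain ⟨z, hz, hz0⟩ := this (show (0 : ℝ) ∈ _ from ⟨by linarith, h1⟩)
    refine ⟨z, hz, ?_⟩
    simp only at hz0
    rcases mul_eq_zero.1 hz0 with h | h
    · rw [h] at h1; simp at h1
    · exact h
  choose β hβ hβ0 using key
  have hmono : StrictMono β := by
    intro i j hij
    have : y i.succ ≤ y j.castSucc := hy.monotone (by
      rw [Fin.le_def]; simpa using hij)
    linarith [(hβ i).2, (hβ j).1]
  refine ⟨β, hmono, ?_, hβ⟩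
  symm
  apply Multiset.eq_of_le_of_card_le
  · rw [Multiset.le_iff_subset ((Finset.univ.nodup).map hmono.injective)]
    intro z hz
    obtain ⟨i, -, rfl⟩ := Multiset.mem_map.1 hz
    rw [Polynomial.mem_roots hq0]
    exact hβ0 i
  · have := Polynomial.card_roots' q
    rw [Polynomial.natDegree_eq_of_degree_eq_some hq] at this
    simpa using this

lemma aux_deriv (n : ℕ) (k : ℝ) (hk : k ≠ 0) (x : Fin n → ℝ) (hx : StrictMono x)
    (f : Polynomial ℝ) (hf : f = C k * ∏ i, (X - C (x i))) (j : Fin n) :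
    0 < k * (-1) ^ (n + 1 + (j : ℕ)) * f.derivative.eval (x j) := by
  have hd : f.derivative.eval (x j) = k * ∏ l ∈ Finset.univ.erase j, (x j - x l) := by
    rw [hf, ← Finset.mul_prod_erase _ _ (Finset.mem_univ j)]
    simp [Polynomial.derivative_mul, Polynomial.eval_prod]
  have hpos : 0 < ∏ l ∈ Finset.univ.erase j, ((if j < l then (-1 : ℝ) else 1) * (x j - x l)) := by
    apply Finset.prod_pos
    intro l hl
    have hne := Finset.ne_of_mem_erase hl
    rcases lt_or_gt_of_ne hne with h | h
    · rw [if_neg h.not_gt]; linarith [hx h]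
    · rw [if_pos h]; linarith [hx h]
  rw [Finset.prod_mul_distrib, Finset.prod_ite] at hpos
  have hc : (Finset.univ.erase j).filter (fun l => j < l) = Finset.Ioi j := by
    ext l; simp only [Finset.mem_filter, Finset.mem_erase, Finset.mem_univ, Finset.mem_Ioi]
    constructor
    · exact fun h => h.2
    · exact fun h => ⟨⟨h.ne', trivial⟩, h⟩
  simp only [hc, Finset.prod_const, Fin.card_Ioi, one_pow, mul_one] at hpos
  have he : ((-1 : ℝ)) ^ (n + 1 + (j : ℕ)) = (-1) ^ (n - 1 - (j : ℕ)) := by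
    have : n + 1 + (j : ℕ) = (n - 1 - (j : ℕ)) + 2 * (j + 1) := by have := j.2; omega
    rw [this, pow_add, pow_mul]; simp
  rw [hd, he]
  have : 0 < k ^ 2 := by positivity
  have := mul_pos this hpos
  linarith

lemma aux_wr (a b c : ℕ → ℝ) (ha : ∀ n, a n ≠ 0) (hac : ∀ n : ℕ, 0 < a n * c (n + 1))
    (p : ℕ → Polynomial ℝ) (hp0 : p 0 = 1)
    (hrec0 : X * p 0 = C (a 0) * p 1 + C (b 0) * p 0)
    (hrec : ∀ n : ℕ, X * p (n + 1) =
      C (a (n + 1)) * p (n + 2) + C (b (n + 1)) * p (n + 1) + C (c (n + 1)) * p n) (x : ℝ) (n : ℕ) :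
    0 < a n * ((p (n + 1)).derivative.eval x * (p n).eval x
      - (p (n + 1)).eval x * (p n).derivative.eval x) := by
  induction n with
  | zero =>
    have h := congrArg (fun f => (derivative f).eval x) hrec0
    simp [hp0] at h
    simp [hp0, ← h]
  | succ n ih =>
    have h1 := congrArg (fun f => f.eval x) (hrec n)
    have h2 := congrArg (fun f => (derivative f).eval x) (hrec n)
    simp at h1 h2
    set D := ((p (n + 1)).derivative.eval x * (p n).eval x
      - (p (n + 1)).eval x * (p n).derivative.eval x) with hD
    have hcD : 0 < c (n + 1) * D := by
      have := mul_pos (hac n) ih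
      have h3 : 0 < a n ^ 2 := by have := ha n; positivity
      have h4 : a n * c (n + 1) * (a n * D) = a n ^ 2 * (c (n + 1) * D) := by ring
      rw [h4] at this
      exact (mul_pos_iff_of_pos_left h3).1 this
    have : a (n + 1) * ((p (n + 1 + 1)).derivative.eval x * (p (n + 1)).eval x
      - (p (n + 1 + 1)).eval x * (p (n + 1)).derivative.eval x)
      = (p (n + 1)).eval x ^ 2 + c (n + 1) * D := by
      rw [hD]
      linear_combination (-(p (n + 1)).eval x) * h2 + (p (n + 1)).derivative.eval x * h1
    rw [this]
    positivity

lemma aux_Cmul (k : ℝ) (f : Polynomial ℝ) : (C k * f).degree ≤ f.degree := by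
  by_cases hk : k = 0
  · simp [hk]
  · rw [degree_C_mul hk]

lemma aux_deg_s12 (a b c : ℕ → ℝ) (ha : ∀ n, a n ≠ 0)
    (p : ℕ → Polynomial ℝ) (hp0 : p 0 = 1)
    (hrec0 : X * p 0 = C (a 0) * p 1 + C (b 0) * p 0)
    (hrec : ∀ n : ℕ, X * p (n + 1) =
      C (a (n + 1)) * p (n + 2) + C (b (n + 1)) * p (n + 1) + C (c (n + 1)) * p n) (n : ℕ) :
    (p n).degree = n ∧ (p (n + 1)).degree = (n + 1 : ℕ) ∧
      (p n).coeff n = a n * (p (n + 1)).coeff (n + 1) := by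
  have mk : ∀ (n : ℕ) (q r : Polynomial ℝ) (a : ℝ), a ≠ 0 → q.degree = n →
      r.degree < (n + 1 : ℕ) → X * q = C a * (p (n + 1)) + r →
      (p (n + 1)).degree = (n + 1 : ℕ) ∧ q.coeff n = a * (p (n + 1)).coeff (n + 1) := by
    intro n q r a ha hq hr h
    constructor
    · have h1 : C a * p (n + 1) = X * q - r := by rw [h]; ring
      have h2 : (X * q : Polynomial ℝ).degree = ((n + 1 : ℕ) : WithBot ℕ) := by
        rw [degree_mul, hq, degree_X]; push_cast; ring
      rw [← degree_C_mul ha, h1, degree_sub_eq_left_of_degree_lt (by rw [h2]; exact hr), h2]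
    · have := congrArg (fun f => f.coeff (n + 1)) h
      simpa [coeff_X_mul, coeff_eq_zero_of_degree_lt hr] using this
  induction n with
  | zero =>
    refine ⟨by simp [hp0], mk 0 (p 0) (C (b 0) * p 0) (a 0) (ha 0) (by simp [hp0]) ?_ hrec0⟩
    rw [hp0, mul_one]
    exact lt_of_le_of_lt degree_C_le (by norm_num)
  | succ n ih =>
    refine ⟨ih.2.1, mk (n + 1) (p (n + 1)) (C (b (n + 1)) * p (n + 1) + C (c (n + 1)) * p n)
      (a (n + 1)) (ha _) ih.2.1 ?_ (by rw [hrec n]; ring)⟩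
    refine lt_of_le_of_lt (degree_add_le _ _) (max_lt ?_ ?_)
    · refine lt_of_le_of_lt (aux_Cmul _ _) ?_
      rw [ih.2.1]; exact_mod_cast Nat.lt_succ_self _
    · refine lt_of_le_of_lt (aux_Cmul _ _) ?_
      rw [ih.1]; exact_mod_cast (by omega : n < n + 1 + 1)

lemma aux_fact_s12 (n : ℕ) (f : Polynomial ℝ) (hf : f.degree = n) (x : Fin n → ℝ)
    (h : f.roots = Multiset.map x Finset.univ.val) :
    f = C (f.coeff n) * ∏ i, (X - C (x i)) := by
  have hn := natDegree_eq_of_degree_eq_some hf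
  have := C_leadingCoeff_mul_prod_multiset_X_sub_C (p := f) (by rw [h, hn]; simp)
  rw [h, Multiset.map_map, leadingCoeff, hn] at this
  exact this.symm

lemma aux_degsum (p : ℕ → Polynomial ℝ) (hp : ∀ n, (p n).degree = n) (d : ℕ → ℝ) (m : ℕ)
    (hd : d m ≠ 0) : (∑ n ∈ Finset.range (m + 1), C (d n) * p n).degree = m := by
  rw [Finset.sum_range_succ, degree_add_eq_right_of_degree_lt, degree_C_mul hd, hp]
  rw [degree_C_mul hd, hp]
  refine lt_of_le_of_lt (degree_sum_le _ _) ?_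
  rw [Finset.sup_lt_iff (by exact WithBot.bot_lt_coe m)]
  intro n hn
  refine lt_of_le_of_lt (aux_Cmul _ _) ?_
  rw [hp]; exact_mod_cast Finset.mem_range.1 hn

lemma aux_main (p : ℕ → Polynomial ℝ) (hp : ∀ n, (p n).degree = n) (α : ℕ → ℝ)
    (hα : ∀ n, α n ≠ 0) (m : ℕ) (y : Fin (m + 1) → ℝ)
    (hy : StrictMono y) (s : ℝ) (hs : ∀ i : Fin (m + 1), 0 < s * (-1) ^ (i : ℕ) * (p m).eval (y i)) :
    ∀ᶠ t : ℝ in Filter.atTop, ∃ β : Fin m → ℝ, StrictMono β ∧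
      (∑ n ∈ Finset.range (m + 1), C (t ^ n * α n) * p n).degree = m ∧
      (∑ n ∈ Finset.range (m + 1), C (t ^ n * α n) * p n).roots =
        Multiset.map β Finset.univ.val ∧
      ∀ i : Fin m, y i.castSucc < β i ∧ β i < y i.succ := by
  have h1 : ∀ i : Fin (m + 1), ∀ᶠ t : ℝ in Filter.atTop, 0 < (s * α m) * (-1) ^ (i : ℕ) *
      (∑ n ∈ Finset.range (m + 1), C (t ^ n * α n) * p n).eval (y i) := by
    intro i
    obtain ⟨ε, hε, h⟩ := aux_large m
      (fun n => (s * α m) * (-1) ^ (i : ℕ) * (α n * (p n).eval (y i))) (by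
        have h2 : 0 < α m ^ 2 := by have := hα m; positivity
        have := mul_pos h2 (hs i)
        linarith)
    filter_upwards [h] with t ht
    refine lt_of_lt_of_le hε (ht.trans_eq ?_)
    rw [eval_finsetSum, Finset.mul_sum]
    refine Finset.sum_congr rfl fun n _ => ?_
    rw [eval_mul, eval_C]; ring
  filter_upwards [Filter.eventually_all.2 h1, Filter.eventually_gt_atTop 0] with t ht ht0
  have hdeg := aux_degsum p hp (fun n => t ^ n * α n) m (mul_ne_zero (by positivity) (hα m))
  obtain ⟨β, hb1, hb2, hb3⟩ := aux_roots_s12 m _ hdeg y hy _ ht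
  exact ⟨β, hb1, hdeg, hb2, hb3⟩

/-- for every `N ≥ 1` there is `T > 0` such that for `t > T`:
(i) the zeros `β_1 < … < β_N` of `x ↦ q_N(x;t)` are real and simple and interlace with
the zeros `x_1^{N+1} < … < x_{N+1}^{N+1}` of `p_{N+1}`: `x_i^{N+1} < β_i < x_{i+1}^{N+1}`;
(ii) the zeros `γ_1 < … < γ_{N+1}` of `x ↦ q_{N+1}(x;t)` are real and simple and
interlace with the zeros `x_1^N < … < x_N^N` of `p_N`: `γ_i < x_i^N < γ_{i+1}`. -/
theorem interlacing_with_orthogonal_zeros_for_large_t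
    (a b c : ℕ → ℝ) (ha : ∀ n, a n ≠ 0) (hac : ∀ n : ℕ, 0 < a n * c (n + 1))
    (p : ℕ → Polynomial ℝ)
    (hp0 : p 0 = 1)
    (hrec0 : Polynomial.X * p 0 = Polynomial.C (a 0) * p 1 + Polynomial.C (b 0) * p 0)
    (hrec : ∀ n : ℕ, Polynomial.X * p (n + 1) =
      Polynomial.C (a (n + 1)) * p (n + 2) + Polynomial.C (b (n + 1)) * p (n + 1)
        + Polynomial.C (c (n + 1)) * p n)
    (α : ℕ → ℝ) (hα0 : α 0 = 1) (hα : ∀ n, α n ≠ 0)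
    (N : ℕ) (hN : 1 ≤ N)
    -- the simple real zeros x_1^N < … < x_N^N of p_N
    (xN : Fin N → ℝ) (hxN : StrictMono xN)
    (hrootsN : (p N).roots = Multiset.map xN Finset.univ.val)
    -- the simple real zeros x_1^{N+1} < … < x_{N+1}^{N+1} of p_{N+1}
    (xN1 : Fin (N + 1) → ℝ) (hxN1 : StrictMono xN1)
    (hrootsN1 : (p (N + 1)).roots = Multiset.map xN1 Finset.univ.val) :
    ∃ T : ℝ, 0 < T ∧ ∀ t : ℝ, T < t →
      ∃ (β : Fin N → ℝ) (γ : Fin (N + 1) → ℝ),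
        StrictMono β ∧ StrictMono γ ∧
        (∑ n ∈ Finset.range (N + 1), Polynomial.C (t ^ n * α n) * p n).degree = N ∧
        (∑ n ∈ Finset.range (N + 1), Polynomial.C (t ^ n * α n) * p n).roots =
          Multiset.map β Finset.univ.val ∧
        (∑ n ∈ Finset.range (N + 2), Polynomial.C (t ^ n * α n) * p n).degree = (N + 1 : ℕ) ∧
        (∑ n ∈ Finset.range (N + 2), Polynomial.C (t ^ n * α n) * p n).roots =
          Multiset.map γ Finset.univ.val ∧
        (∀ i : Fin N, xN1 i.castSucc < β i ∧ β i < xN1 i.succ) ∧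
        (∀ i : Fin N, γ i.castSucc < xN i ∧ xN i < γ i.succ) := by
  have hdeg := aux_deg_s12 a b c ha p hp0 hrec0 hrec
  have hp := fun n => (hdeg n).1
  have hW := fun x => aux_wr a b c ha hac p hp0 hrec0 hrec x N
  have hk := (hdeg N).2.2
  have hcoef : ∀ n, (p n).coeff n ≠ 0 := fun n => coeff_ne_zero_of_eq_degree (hp n)
  set k := (p (N + 1)).coeff (N + 1) with hkdef
  have hk0 : k ≠ 0 := hcoef (N + 1)
  have hf := aux_fact_s12 N _ (hp N) xN hrootsN
  have hf1 := aux_fact_s12 (N + 1) _ (hp (N + 1)) xN1 hrootsN1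
  rw [hk] at hf
  rw [← hkdef] at hf1
  have hd := aux_deriv N _ (mul_ne_zero (ha N) hk0) xN hxN _ hf
  have hd1 := aux_deriv (N + 1) _ hk0 xN1 hxN1 _ hf1
  have hr : ∀ i, (p N).eval (xN i) = 0 := fun i => by
    have : xN i ∈ (p N).roots := by rw [hrootsN]; simp
    exact (mem_roots'.1 this).2
  have hr1 : ∀ i, (p (N + 1)).eval (xN1 i) = 0 := fun i => by
    have : xN1 i ∈ (p (N + 1)).roots := by rw [hrootsN1]; exact Multiset.mem_map_of_mem _ (Finset.mem_univ i)
    exact (mem_roots'.1 this).2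
  -- part (i) signs
  have hs1 : ∀ i : Fin (N + 1),
      0 < (a N * k * (-1) ^ N) * (-1) ^ (i : ℕ) * (p N).eval (xN1 i) := by
    intro i
    have h1 := hW (xN1 i)
    rw [hr1 i, zero_mul, sub_zero] at h1
    have h2 := mul_pos (hd1 i) h1
    have h3 : 0 < (p (N + 1)).derivative.eval (xN1 i) ^ 2 := by
      have : (p (N + 1)).derivative.eval (xN1 i) ≠ 0 := by
        intro h; rw [h] at h1; simp at h1
      positivity
    refine (mul_pos_iff_of_pos_left h3).1 (h2.trans_eq ?_)
    ring
  set B : ℝ := 1 + ∑ i, |xN i| + ∑ i, |xN1 i| with hB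
  have hs0 : 0 ≤ ∑ i, |xN i| := Finset.sum_nonneg fun _ _ => abs_nonneg _
  have hs0' : 0 ≤ ∑ i, |xN1 i| := Finset.sum_nonneg fun _ _ => abs_nonneg _
  have hBN : ∀ i, |xN i| < B := fun i => by
    have := Finset.single_le_sum (f := fun i => |xN i|) (fun _ _ => abs_nonneg _)
      (Finset.mem_univ i)
    linarith
  have hBN1 : ∀ i, |xN1 i| < B := fun i => by
    have := Finset.single_le_sum (f := fun i => |xN1 i|) (fun _ _ => abs_nonneg _)
      (Finset.mem_univ i)
    linarith
  have hB0 : 0 < B := by linarith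
  set y : Fin (N + 2) → ℝ := Fin.cons (-B) (Fin.snoc xN B : Fin (N + 1) → ℝ) with hy
  have hsn : StrictMono (Fin.snoc xN B : Fin (N + 1) → ℝ) := by
    intro i j hij
    induction j using Fin.lastCases with
    | last =>
      induction i using Fin.lastCases with
      | last => exact absurd hij (lt_irrefl _)
      | cast i => simpa using (abs_lt.1 (hBN i)).2
    | cast j =>
      induction i using Fin.lastCases with
      | last => exact absurd hij (not_lt.2 (Fin.le_last _))
      | cast i => simpa using hxN (by simpa using hij)
  have hlow : ∀ j, -B < (Fin.snoc xN B : Fin (N + 1) → ℝ) j := by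
    intro j
    induction j using Fin.lastCases with
    | last => simp; linarith
    | cast j => simpa using (abs_lt.1 (hBN j)).1
  have hymono : StrictMono y := by
    intro i j hij
    induction j using Fin.cases with
    | zero => exact absurd hij (not_lt.2 (Fin.zero_le _))
    | succ j =>
      induction i using Fin.cases with
      | zero => simpa [hy] using hlow j
      | succ i => simpa [hy] using hsn (by simpa using hij)
  have hk2 : 0 < k ^ 2 := by positivity
  have hev : ∀ x, (p (N + 1)).eval x = k * ∏ i, (x - xN1 i) := by
    intro x; rw [hf1]; simp [eval_prod]
  have hs2 : ∀ i : Fin (N + 1 + 1),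
      0 < (k * (-1) ^ (N + 1)) * (-1) ^ (i : ℕ) * (p (N + 1)).eval (y i) := by
    intro i
    induction i using Fin.cases with
    | zero =>
      have h1 : 0 < ∏ i, (-1) * (-B - xN1 i) := Finset.prod_pos fun i _ => by
        linarith [(abs_lt.1 (hBN1 i)).1]
      rw [Finset.prod_mul_distrib] at h1
      simp only [Finset.prod_const, Finset.card_univ, Fintype.card_fin] at h1
      rw [hev, hy]
      simp only [Fin.cons_zero, Fin.val_zero, pow_zero]
      linarith [mul_pos hk2 h1]
    | succ i =>
      have e : y i.succ = (Fin.snoc xN B : Fin (N + 1) → ℝ) i := by simp [hy]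
      rw [e]
      induction i using Fin.lastCases with
      | last =>
        have h1 : 0 < ∏ i, (B - xN1 i) := Finset.prod_pos fun i _ => by
          linarith [(abs_lt.1 (hBN1 i)).2]
        rw [Fin.snoc_last, hev, Fin.val_succ, Fin.val_last]
        have h2 : ((-1 : ℝ) ^ (N + 1)) * (-1) ^ (N + 1) = 1 := by
          rw [← mul_pow]; simp
        refine (mul_pos hk2 h1).trans_eq ?_
        linear_combination (-(k ^ 2 * ∏ i, (B - xN1 i))) * h2
      | cast i =>
        rw [Fin.snoc_castSucc, Fin.val_succ, Fin.val_castSucc]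
        have h1 := hW (xN i)
        rw [hr i, mul_zero, zero_sub] at h1
        have h2 := mul_pos (hd i) h1
        have h3 : 0 < (a N * (p N).derivative.eval (xN i)) ^ 2 := by
          have : (p N).derivative.eval (xN i) ≠ 0 := by
            intro h; rw [h] at h1; simp at h1
          have := ha N
          positivity
        refine (mul_pos_iff_of_pos_left h3).1 (h2.trans_eq ?_)
        ring
  have m1 := aux_main p hp α hα N xN1 hxN1 _ hs1
  have m2 := aux_main p hp α hα (N + 1) y hymono _ hs2
  obtain ⟨T, hT⟩ := Filter.eventually_atTop.1 (m1.and m2)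
  refine ⟨max T 1, by positivity, fun t ht => ?_⟩
  obtain ⟨⟨β, b1, b2, b3, b4⟩, ⟨γ, g1, g2, g3, g4⟩⟩ := hT t ((le_max_left _ _).trans ht.le)
  refine ⟨β, γ, b1, g1, b2, b3, g2, g3, b4, fun i => ⟨?_, ?_⟩⟩
  · simpa [hy] using (g4 i.castSucc).2
  · have := (g4 i.succ).1
    rw [← Fin.succ_castSucc] at this
    simpa [hy] using this
end

section
/- For every N ≥ 1 there exists T > 0 such that for all t > T, every zero of the polynomial x ↦ q_N(x;t) is real and lies strictly between the smallest zero x_1^{N+1} and the largest zero x_{N+1}^{N+1} of p_{N+1}; in particular all zeros of q_N(·;t) lie in the convex hull of the zeros of p_{N+1}. -/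
open Polynomial Finset

lemma aux_eventually (d : ℕ → ℝ) (N : ℕ) (hd : 0 < d N) :
    ∀ᶠ t : ℝ in Filter.atTop, 0 < ∑ n ∈ Finset.range (N + 1), t ^ n * d n := by
  have h : Filter.Tendsto (fun t : ℝ => ∑ n ∈ Finset.range N, t ^ n / t ^ N * d n)
      Filter.atTop (nhds (∑ n ∈ Finset.range N, 0 * d n)) := by
    refine tendsto_finsetSum _ fun n hn => ?_
    exact (tendsto_pow_div_pow_atTop_zero (Finset.mem_range.1 hn)).mul_const _
  simp only [zero_mul, Finset.sum_const_zero] at h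
  filter_upwards [h.eventually (lt_mem_nhds (neg_lt_zero.2 hd)), Filter.eventually_gt_atTop 0]
    with t h1 h2
  have h3 : 0 < t ^ N := by positivity
  have h4 : ∑ n ∈ Finset.range (N + 1), t ^ n * d n
      = t ^ N * ((∑ n ∈ Finset.range N, t ^ n / t ^ N * d n) + d N) := by
    rw [Finset.sum_range_succ, mul_add, Finset.mul_sum]
    congr 1
    refine Finset.sum_congr rfl fun n _ => ?_
    field_simp
  rw [h4]
  exact mul_pos h3 (by linarith)

lemma aux_sum {N : ℕ} (x m : Fin (N + 1) → ℝ) (hx : StrictMono x) (hm : ∀ i, 0 < m i) (z : ℂ)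
    (hz : ∀ i, z ≠ (x i : ℂ)) (h : ∑ i, (m i : ℂ) * (z - x i)⁻¹ = 0) :
    z.im = 0 ∧ x 0 < z.re ∧ z.re < x (Fin.last N) := by
  have hns : ∀ i, 0 < Complex.normSq (z - x i) := fun i =>
    Complex.normSq_pos.2 (sub_ne_zero.2 (hz i))
  have him : ∑ i, m i / Complex.normSq (z - x i) * z.im = 0 := by
    have := congrArg Complex.im h
    simp [Complex.inv_im] at this
    rw [← neg_eq_zero, ← this, ← Finset.sum_neg_distrib]
    refine Finset.sum_congr rfl fun i _ => ?_
    ring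
  have hre : ∑ i, m i / Complex.normSq (z - x i) * (z.re - x i) = 0 := by
    have := congrArg Complex.re h
    simp [Complex.inv_re] at this
    rw [← this]
    refine Finset.sum_congr rfl fun i _ => ?_
    ring
  have hq : ∀ i, 0 < m i / Complex.normSq (z - x i) := fun i => div_pos (hm i) (hns i)
  have h0 : z.im = 0 := by
    rw [← Finset.sum_mul] at him
    exact (mul_eq_zero.1 him).resolve_left
      (Finset.sum_pos (fun i _ => hq i) Finset.univ_nonempty).ne'
  have hne : ∀ i, z.re ≠ x i := fun i hi => hz i (Complex.ext (by simpa using hi) (by simpa using h0))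
  refine ⟨h0, ?_, ?_⟩
  · by_contra hc
    have : ∑ i, m i / Complex.normSq (z - x i) * (z.re - x i) < ∑ i : Fin (N + 1), (0 : ℝ) := by
      refine Finset.sum_lt_sum_of_nonempty Finset.univ_nonempty fun i _ => ?_
      have h1 := hx.monotone (Fin.zero_le i)
      have h2 := lt_of_le_of_ne ((not_lt.1 hc).trans h1) (hne i)
      exact mul_neg_of_pos_of_neg (hq i) (by linarith)
    simp [hre] at this
  · by_contra hc
    have : ∑ i : Fin (N + 1), (0 : ℝ) < ∑ i, m i / Complex.normSq (z - x i) * (z.re - x i) := by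
      refine Finset.sum_lt_sum_of_nonempty Finset.univ_nonempty fun i _ => ?_
      have h1 := hx.monotone (Fin.le_last i)
      have h2 := lt_of_le_of_ne (h1.trans (not_lt.1 hc)) (hne i).symm
      exact mul_pos (hq i) (by linarith)
    simp [hre] at this

lemma aux_degree (a b c : ℕ → ℝ) (ha : ∀ n, a n ≠ 0)
    (p : ℕ → Polynomial ℝ)
    (hp0 : p 0 = 1)
    (hrec0 : Polynomial.X * p 0 = Polynomial.C (a 0) * p 1 + Polynomial.C (b 0) * p 0)
    (hrec : ∀ n : ℕ, Polynomial.X * p (n + 1) =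
      Polynomial.C (a (n + 1)) * p (n + 2) + Polynomial.C (b (n + 1)) * p (n + 1)
        + Polynomial.C (c (n + 1)) * p n) (n : ℕ) :
    (p n).natDegree ≤ n ∧ (p (n + 1)).natDegree ≤ n + 1 := by
  induction n with
  | zero =>
    refine ⟨by simp [hp0], ?_⟩
    rw [← natDegree_C_mul (ha 0)]
    have : C (a 0) * p 1 = X * p 0 - C (b 0) * p 0 := by rw [hrec0]; ring
    rw [this, hp0]
    compute_degree
  | succ n ih =>
    refine ⟨ih.2, ?_⟩
    rw [← natDegree_C_mul (ha (n+1))]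
    have : C (a (n + 1)) * p (n + 2) =
      X * p (n + 1) - C (b (n + 1)) * p (n + 1) - C (c (n + 1)) * p n := by rw [hrec]; ring
    rw [this]
    have h1 : (X * p (n + 1)).natDegree ≤ n + 1 + 1 := by
      refine natDegree_mul_le.trans ?_
      rw [natDegree_X]; omega
    have h2 := (natDegree_C_mul_le (b (n + 1)) (p (n + 1))).trans ih.2
    have h3 := (natDegree_C_mul_le (c (n + 1)) (p n)).trans ih.1
    refine (natDegree_sub_le_of_le (natDegree_sub_le_of_le h1 h2) h3).trans ?_
    simp
    omega

lemma aux_wronskian (a b c : ℕ → ℝ) (ha : ∀ n, a n ≠ 0) (hac : ∀ n : ℕ, 0 < a n * c (n + 1))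
    (p : ℕ → Polynomial ℝ)
    (hp0 : p 0 = 1)
    (hrec0 : Polynomial.X * p 0 = Polynomial.C (a 0) * p 1 + Polynomial.C (b 0) * p 0)
    (hrec : ∀ n : ℕ, Polynomial.X * p (n + 1) =
      Polynomial.C (a (n + 1)) * p (n + 2) + Polynomial.C (b (n + 1)) * p (n + 1)
        + Polynomial.C (c (n + 1)) * p n) (x : ℝ) (n : ℕ) :
    0 < a n * ((derivative (p (n + 1))).eval x * (p n).eval x
      - (derivative (p n)).eval x * (p (n + 1)).eval x) := by
  induction n with
  | zero =>
    have h := congrArg (fun q => (derivative q).eval x) hrec0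
    simp [hp0] at h
    simp [hp0, ← h]
  | succ n ih =>
    have h := congrArg (fun q => (derivative q).eval x) (hrec n)
    have h' := congrArg (fun q => q.eval x) (hrec n)
    simp at h h'
    set W := (derivative (p (n + 1))).eval x * (p n).eval x
      - (derivative (p n)).eval x * (p (n + 1)).eval x with hW
    have key : a (n + 1) * ((derivative (p (n + 1 + 1))).eval x * (p (n + 1)).eval x
      - (derivative (p (n + 1))).eval x * (p (n + 1 + 1)).eval x) =
        (p (n + 1)).eval x ^ 2 + c (n + 1) * W := by
      rw [hW]
      linear_combination (-(p (n + 1)).eval x) * h + (derivative (p (n + 1))).eval x * h'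
    rw [key]
    have : 0 < c (n + 1) * W := by
      have h1 : 0 < (a n * c (n + 1)) * (a n * W) := mul_pos (hac n) ih
      have h2 : (a n * c (n + 1)) * (a n * W) = a n ^ 2 * (c (n + 1) * W) := by ring
      rw [h2] at h1
      exact pos_of_mul_pos_right h1 (sq_nonneg _)
    positivity

/-- for every `N ≥ 1` there exists `T > 0` such that for all `t > T`,
every (complex) zero of `x ↦ q_N(x;t)` is real and lies strictly between the smallest
zero `x_1^{N+1}` and the largest zero `x_{N+1}^{N+1}` of `p_{N+1}`; in particular all
zeros of `q_N(·;t)` lie in the convex hull of the zeros of `p_{N+1}`. -/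
theorem zeros_in_convex_hull_for_large_t
    (a b c : ℕ → ℝ) (ha : ∀ n, a n ≠ 0) (hac : ∀ n : ℕ, 0 < a n * c (n + 1))
    (p : ℕ → Polynomial ℝ)
    (hp0 : p 0 = 1)
    (hrec0 : Polynomial.X * p 0 = Polynomial.C (a 0) * p 1 + Polynomial.C (b 0) * p 0)
    (hrec : ∀ n : ℕ, Polynomial.X * p (n + 1) =
      Polynomial.C (a (n + 1)) * p (n + 2) + Polynomial.C (b (n + 1)) * p (n + 1)
        + Polynomial.C (c (n + 1)) * p n)
    (α : ℕ → ℝ) (hα0 : α 0 = 1) (hα : ∀ n, α n ≠ 0)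
    (N : ℕ) (hN : 1 ≤ N)
    -- the simple real zeros x_1^{N+1} < … < x_{N+1}^{N+1} of p_{N+1}
    (xN1 : Fin (N + 1) → ℝ) (hxN1 : StrictMono xN1)
    (hrootsN1 : (p (N + 1)).roots = Multiset.map xN1 Finset.univ.val) :
    ∃ T : ℝ, 0 < T ∧ ∀ t : ℝ, T < t →
      ∀ z : ℂ,
        ((∑ n ∈ Finset.range (N + 1), Polynomial.C (t ^ n * α n) * p n).map
            (algebraMap ℝ ℂ)).IsRoot z →
          z.im = 0 ∧ xN1 0 < z.re ∧ z.re < xN1 (Fin.last N) := by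
  have hdeg := aux_degree a b c ha p hp0 hrec0 hrec
  have hW := fun x => aux_wronskian a b c ha hac p hp0 hrec0 hrec x N
  have hroot : ∀ i, (p (N + 1)).eval (xN1 i) = 0 := by
    intro i
    have : xN1 i ∈ (p (N + 1)).roots := by
      rw [hrootsN1]; exact Multiset.mem_map_of_mem _ (Finset.mem_univ_val i)
    exact isRoot_of_mem_roots this
  have hcard : (p (N + 1)).roots.card = N + 1 := by rw [hrootsN1]; simp
  have hnd : (p (N + 1)).roots.card = (p (N + 1)).natDegree :=
    le_antisymm (card_roots' _) (by rw [hcard]; exact (hdeg N).2)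
  set l := (p (N + 1)).leadingCoeff with hl
  have hfac : p (N + 1) = C l * Lagrange.nodal Finset.univ xN1 := by
    rw [← C_leadingCoeff_mul_prod_multiset_X_sub_C hnd, hrootsN1, Multiset.map_map]
    rfl
  set w : Fin (N + 1) → ℝ := Lagrange.nodalWeight Finset.univ xN1 with hw
  have hw0 : ∀ i, w i ≠ 0 := fun i =>
    Lagrange.nodalWeight_ne_zero hxN1.injective.injOn (Finset.mem_univ i)
  have hder : ∀ i, (derivative (p (N + 1))).eval (xN1 i) = l * (w i)⁻¹ := by
    intro i
    rw [hfac, derivative_C_mul, eval_mul, eval_C, hw,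
      Lagrange.nodalWeight_eq_eval_derivative_nodal (Finset.mem_univ i), inv_inv]
  have hpos : ∀ i, 0 < a N * l * w i * (p N).eval (xN1 i) := by
    intro i
    have h := hW (xN1 i)
    rw [hroot, hder, mul_zero, sub_zero] at h
    have h2 : 0 < w i ^ 2 := by have := hw0 i; positivity
    have h3 := mul_pos h2 h
    have h4 : w i ^ 2 * (a N * (l * (w i)⁻¹ * (p N).eval (xN1 i)))
      = a N * l * w i * (p N).eval (xN1 i) := by
      have := hw0 i
      field_simp
    rwa [h4] at h3
  have hpN : ∀ i, (p N).eval (xN1 i) ≠ 0 := fun i h => by simpa [h] using hpos i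
  have hev : ∀ᶠ t : ℝ in Filter.atTop, ∀ i, 0 < ∑ n ∈ Finset.range (N + 1),
      t ^ n * (α n * (p n).eval (xN1 i) * (α N * (p N).eval (xN1 i))) := by
    rw [Filter.eventually_all]
    intro i
    refine aux_eventually (fun n => α n * (p n).eval (xN1 i) * (α N * (p N).eval (xN1 i))) N ?_
    exact mul_self_pos.2 (mul_ne_zero (hα N) (hpN i))
  obtain ⟨T, hT⟩ := Filter.eventually_atTop.1 hev
  refine ⟨max T 1, by positivity, fun t ht z hz => ?_⟩
  have ht' := hT t ((le_max_left _ _).trans ht.le)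
  set q := ∑ n ∈ Finset.range (N + 1), C (t ^ n * α n) * p n with hq
  have hqe : ∀ i, 0 < q.eval (xN1 i) * (α N * (p N).eval (xN1 i)) := by
    intro i
    convert ht' i using 1
    rw [hq, eval_finsetSum, Finset.sum_mul]
    refine Finset.sum_congr rfl fun n _ => ?_
    simp only [eval_mul, eval_C]; ring
  have hm : ∀ i, 0 < a N * l * α N * w i * q.eval (xN1 i) := by
    intro i
    have h1 := mul_pos (hpos i) (hqe i)
    have h2 : a N * l * w i * (p N).eval (xN1 i) * (q.eval (xN1 i) * (α N * (p N).eval (xN1 i)))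
      = (p N).eval (xN1 i) ^ 2 * (a N * l * α N * w i * q.eval (xN1 i)) := by ring
    rw [h2] at h1
    exact pos_of_mul_pos_right h1 (sq_nonneg _)
  have hmape : ∀ i, (q.map (algebraMap ℝ ℂ)).eval (xN1 i : ℂ) = ((q.eval (xN1 i) : ℝ) : ℂ) := by
    intro i
    exact eval_map_apply (algebraMap ℝ ℂ) (xN1 i)
  have hzne : ∀ i, z ≠ (xN1 i : ℂ) := by
    rintro i rfl
    rw [IsRoot.def, hmape] at hz
    have : q.eval (xN1 i) = 0 := by exact_mod_cast hz
    simpa [this] using hm i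
  refine aux_sum xN1 _ hxN1 hm z hzne ?_
  have hqdeg : (q.map (algebraMap ℝ ℂ)).degree < ((Finset.univ : Finset (Fin (N + 1))).card : ℕ) := by
    refine degree_map_le.trans_lt ?_
    rw [Finset.card_univ, Fintype.card_fin]
    refine degree_le_natDegree.trans_lt ?_
    have : q.natDegree ≤ N := by
      refine natDegree_sum_le_of_forall_le _ _ fun n hn => ?_
      have h1 := Finset.mem_range.1 hn
      exact ((natDegree_C_mul_le _ _).trans (hdeg n).1).trans (by omega)
    exact_mod_cast Nat.lt_succ_of_le this
  have hinj : Set.InjOn (fun i => (xN1 i : ℂ)) ((Finset.univ : Finset (Fin (N + 1))) : Set _) :=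
    (Complex.ofReal_injective.comp hxN1.injective).injOn
  have hint := Lagrange.eq_interpolate hinj hqdeg
  have hev2 : (q.map (algebraMap ℝ ℂ)).eval z = _ := congrArg (fun r => r.eval z) hint
  beta_reduce at hev2
  rw [Lagrange.eval_interpolate_not_at_node _ (fun i _ => hzne i), IsRoot.def.1 hz] at hev2
  have hnod : (Lagrange.nodal Finset.univ (fun i => (xN1 i : ℂ))).eval z ≠ 0 :=
    Lagrange.eval_nodal_not_at_node (fun i _ => hzne i)
  have hs := (mul_eq_zero.1 hev2.symm).resolve_left hnod
  have hwc : ∀ i, Lagrange.nodalWeight Finset.univ (fun i => (xN1 i : ℂ)) i = (w i : ℂ) := by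
    intro i
    simp [hw, Lagrange.nodalWeight]
  rw [← mul_zero ((a N * l * α N : ℝ) : ℂ), ← hs, Finset.mul_sum]
  refine Finset.sum_congr rfl fun i _ => ?_
  rw [hwc, hmape]
  push_cast
  ring
end

section
/- The partial sums of Hermite polynomials satisfy the four-term recurrence (m+1)·q_{m+1}(x;t) − (2xt + m + 1)·q_m(x;t) + 2(t² + tx)·q_{m−1}(x;t) − 2t²·q_{m−2}(x;t) = 0 for all m ≥ 1 and all x, t ∈ ℝ, with the conventions q_{−1} = q_{−2} = 0 and q_0 = 1. -/
open Polynomial Finset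

/-- The physicists' Hermite polynomials:
`H_0 = 1`, `H_1(x) = 2x`, `H_{n+2}(x) = 2x·H_{n+1}(x) − 2(n+1)·H_n(x)`. -/
noncomputable def hermiteH : ℕ → Polynomial ℝ
  | 0 => 1
  | 1 => Polynomial.C 2 * Polynomial.X
  | n + 2 => Polynomial.C 2 * Polynomial.X * hermiteH (n + 1)
      - Polynomial.C (2 * ((n : ℝ) + 1)) * hermiteH n

/-- Partial sums of Hermite polynomials `q_m(x;t) = Σ_{n=0}^m (t^n/n!)·H_n(x)` for
`m ≥ 0`, with the convention `q_m = 0` for `m < 0`. -/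
noncomputable def hermitePS (m : ℤ) (x t : ℝ) : ℝ :=
  if m < 0 then 0
  else ∑ n ∈ Finset.range (m.toNat + 1), t ^ n / n.factorial * (hermiteH n).eval x

theorem hermitePS_term_aux (n : ℕ) (x t : ℝ) :
    ((n : ℝ) + 2) * (t ^ (n + 2) / (n + 2).factorial * (hermiteH (n + 2)).eval x)
      = 2 * x * t * (t ^ (n + 1) / (n + 1).factorial * (hermiteH (n + 1)).eval x)
        - 2 * t ^ 2 * (t ^ n / n.factorial * (hermiteH n).eval x) := by
  have h : (hermiteH (n + 2)).eval x = 2 * x * (hermiteH (n + 1)).eval x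
      - 2 * ((n : ℝ) + 1) * (hermiteH n).eval x := by
    simp [hermiteH]
  have h0 : (n.factorial : ℝ) ≠ 0 := by positivity
  have h1 : (n : ℝ) + 1 ≠ 0 := by positivity
  have h2 : (n : ℝ) + 2 ≠ 0 := by positivity
  have h3 : (n : ℝ) + 1 + 1 ≠ 0 := by positivity
  rw [h, Nat.factorial_succ (n + 1), Nat.factorial_succ n]
  push_cast
  field_simp
  ring

theorem hermitePS_nat_aux (n : ℕ) (x t : ℝ) : hermitePS (n : ℤ) x t
    = ∑ k ∈ Finset.range (n + 1), t ^ k / k.factorial * (hermiteH k).eval x := by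
  simp [hermitePS]

theorem hermitePS_succ_aux (n : ℕ) (x t : ℝ) : hermitePS (n : ℤ) x t
    = hermitePS ((n : ℤ) - 1) x t + t ^ n / n.factorial * (hermiteH n).eval x := by
  cases n with
  | zero => simp [hermitePS]
  | succ k =>
    have e : ((k + 1 : ℕ) : ℤ) - 1 = (k : ℤ) := by push_cast; ring
    rw [e, hermitePS_nat_aux, hermitePS_nat_aux, Finset.sum_range_succ _ (k + 1)]

/-- the partial sums of Hermite polynomials satisfy the four-term recurrence
`(m+1)·q_{m+1} − (2xt + m + 1)·q_m + 2(t² + tx)·q_{m−1} − 2t²·q_{m−2} = 0`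
for all `m ≥ 1` and all `x, t ∈ ℝ` (with the conventions `q_{−1} = q_{−2} = 0`). -/
theorem hermitePS_four_term_recurrence (m : ℤ) (hm : 1 ≤ m) (x t : ℝ) :
    ((m : ℝ) + 1) * hermitePS (m + 1) x t
      - (2 * x * t + (m : ℝ) + 1) * hermitePS m x t
      + 2 * (t ^ 2 + t * x) * hermitePS (m - 1) x t
      - 2 * t ^ 2 * hermitePS (m - 2) x t = 0 := by
  obtain ⟨n, rfl⟩ : ∃ n : ℕ, m = (n : ℤ) + 1 := ⟨(m - 1).toNat, by omega⟩
  have a := hermitePS_succ_aux n x t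
  have b := hermitePS_succ_aux (n + 1) x t
  have c := hermitePS_succ_aux (n + 2) x t
  have d := hermitePS_term_aux n x t
  have e1 : ((n + 1 : ℕ) : ℤ) - 1 = (n : ℤ) := by push_cast; ring
  have e2 : ((n + 2 : ℕ) : ℤ) - 1 = (n : ℤ) + 1 := by push_cast; ring
  have e3 : ((n + 2 : ℕ) : ℤ) = (n : ℤ) + 1 + 1 := by push_cast; ring
  have e4 : ((n + 1 : ℕ) : ℤ) = (n : ℤ) + 1 := by push_cast; ring
  have e5 : (n : ℤ) + 1 - 1 = n := by ring
  have e6 : (n : ℤ) + 1 - 2 = n - 1 := by ring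
  rw [e1, e4] at b
  rw [e2, e3] at c
  rw [e5, e6]
  push_cast
  linear_combination ((n : ℝ) + 2) * c - 2 * x * t * b + 2 * t ^ 2 * a + d
end

section
/- Let m ≥ 1 and let x_0, t_0 ∈ ℝ with t_0 ≠ 0 be such that the polynomial x ↦ q_m(x;t_0) has a double zero at x = x_0 (i.e. (x − x_0)² divides q_m(x;t_0)). Then x_0 is a zero of the Hermite polynomial H_m: H_m(x_0) = 0. -/
open Polynomial Finset

/-- The partial sum `q_m(·;t) = Σ_{n=0}^m (t^n/n!)·H_n` as a polynomial in `x`. -/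
noncomputable def hermitePSpoly (m : ℕ) (t : ℝ) : Polynomial ℝ :=
  ∑ n ∈ Finset.range (m + 1), Polynomial.C (t ^ n / n.factorial) * hermiteH n

theorem hermiteH_deriv_aux (n : ℕ) :
    derivative (hermiteH (n + 1)) = C (2 * ((n : ℝ) + 1)) * hermiteH n ∧
    derivative (hermiteH (n + 2)) = C (2 * ((n : ℝ) + 2)) * hermiteH (n + 1) := by
  induction n with
  | zero =>
    constructor
    · simp [hermiteH]
    · simp only [hermiteH, derivative_sub, derivative_mul, derivative_C, derivative_X,
        derivative_one, map_mul, map_add, map_one, map_ofNat, Nat.cast_zero, map_zero,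
        derivative_ofNat, zero_add]
      ring
  | succ n ih =>
    obtain ⟨h1, h2⟩ := ih
    refine ⟨?_, ?_⟩
    · rw [h2]; push_cast; ring_nf
    · have e : hermiteH (n + 1 + 2) = C 2 * X * hermiteH (n + 2)
          - C (2 * (((n + 1 : ℕ) : ℝ) + 1)) * hermiteH (n + 1) := by
        rw [hermiteH]
      have e2 : hermiteH (n + 2) = C 2 * X * hermiteH (n + 1)
          - C (2 * ((n : ℝ) + 1)) * hermiteH n := by
        rw [hermiteH]
      rw [e, derivative_sub, derivative_mul, derivative_mul, derivative_C, derivative_X,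
        derivative_C_mul, h1, h2]
      show _ = _ * hermiteH (n + 2)
      rw [e2]
      simp only [map_mul, map_add, map_one, map_ofNat, Nat.cast_add, Nat.cast_one]
      ring

theorem hermitePS_deriv_aux (m : ℕ) (t : ℝ) :
    derivative (hermitePSpoly m t) =
      C (2 * t) * (hermitePSpoly m t - C (t ^ m / m.factorial) * hermiteH m) := by
  induction m with
  | zero => simp [hermitePSpoly, hermiteH]
  | succ m ih =>
    have e : hermitePSpoly (m + 1) t = hermitePSpoly m t
        + C (t ^ (m + 1) / (m + 1).factorial) * hermiteH (m + 1) := by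
      rw [hermitePSpoly, Finset.sum_range_succ, ← hermitePSpoly]
    rw [e, derivative_add, ih, derivative_C_mul, (hermiteH_deriv_aux m).1]
    have hc : t ^ (m + 1) / ((m + 1).factorial : ℝ) * (2 * ((m : ℝ) + 1))
        = 2 * t * (t ^ m / m.factorial) := by
      rw [Nat.factorial_succ]
      push_cast
      have : (m.factorial : ℝ) ≠ 0 := by positivity
      have : (m : ℝ) + 1 ≠ 0 := by positivity
      field_simp
      ring
    rw [← mul_assoc, ← C_mul, hc, C_mul (a := 2 * t) (b := t ^ m / (m.factorial : ℝ))]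
    ring

/-- if `m ≥ 1`, `t₀ ≠ 0` and the polynomial `x ↦ q_m(x;t₀)` has a double
zero at `x₀` (i.e. `(x − x₀)²` divides `q_m(x;t₀)`), then `H_m(x₀) = 0`. -/
theorem hermitePS_double_zero_at_hermite_zero
    (m : ℕ) (hm : 1 ≤ m) (x₀ t₀ : ℝ) (ht₀ : t₀ ≠ 0)
    (hdouble : (Polynomial.X - Polynomial.C x₀) ^ 2 ∣ hermitePSpoly m t₀) :
    (hermiteH m).eval x₀ = 0 := by
  obtain ⟨r, hr⟩ := hdouble
  have h0 : (hermitePSpoly m t₀).eval x₀ = 0 := by rw [hr]; simp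
  have h1 : (derivative (hermitePSpoly m t₀)).eval x₀ = 0 := by
    rw [hr, derivative_mul, derivative_X_sub_C_sq]; simp
  rw [hermitePS_deriv_aux] at h1
  simp only [eval_mul, eval_sub, eval_C, h0] at h1
  have : (m.factorial : ℝ) ≠ 0 := by positivity
  simpa [ht₀, this] using h1
end
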